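/- arXiv:0710.2648 — 2 statements merged into one kernel-verified Lean document; each statement's English description precedes it below -/
import Mathlib

section
/- For all partitions μ, ν, ρ, λ the Littlewood–Richardson coefficients satisfy Σ_κ c^κ_{μν} c^κ_{ρλ} = Σ_{σ,τ,α,β} c^ρ_{στ} c^μ_{σα} c^ν_{τβ} c^λ_{αβ}, where all sums run over all partitions (only finitely many terms are nonzero). Equivalently, the skew of a product of Schur functions satisfies s_{(μ·ν)/ρ} = Σ_{σ,τ} c^ρ_{στ} s_{μ/σ} · s_{ν/τ}. -/
open MvPolynomial
open scoped Classical

/-- A partition: a weakly decreasing sequence of non-negative integers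
with finitely many nonzero parts (indexed from 0). -/
structure Partn where
  parts : ℕ → ℕ
  antitone : ∀ i j, i ≤ j → parts j ≤ parts i
  eventually_zero : ∃ N, ∀ i, N ≤ i → parts i = 0

namespace Partn

/-- The weight `|λ|` of a partition: the sum of its parts. -/
noncomputable def weight (p : Partn) : ℕ := ∑ᶠ i, p.parts i

/-- `ℓ(λ) ≤ n`: all parts from index `n` on vanish. -/
def LengthLE (p : Partn) (n : ℕ) : Prop := ∀ i, n ≤ i → p.parts i = 0

/-- The parts of the conjugate partition `λ'`:
`λ'_i` is the number of indices `j` with `λ_j > i`. -/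
noncomputable def conjParts (p : Partn) (i : ℕ) : ℕ := Nat.card {j : ℕ // i < p.parts j}

end Partn

/-- The alternant `det(x_i^{l_j + n - j})_{1 ≤ i,j ≤ n}` (indices taken 0-based). -/
noncomputable def alternant (n : ℕ) (l : ℕ → ℕ) : MvPolynomial (Fin n) ℤ :=
  (Matrix.of fun i j : Fin n =>
    (X i : MvPolynomial (Fin n) ℤ) ^ (l (j : ℕ) + (n - 1 - (j : ℕ)))).det

/-- The Vandermonde determinant `det(x_i^{n-j})_{1 ≤ i,j ≤ n}` (0-based). -/
noncomputable def vandermondeP (n : ℕ) : MvPolynomial (Fin n) ℤ :=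
  (Matrix.of fun i j : Fin n =>
    (X i : MvPolynomial (Fin n) ℤ) ^ (n - 1 - (j : ℕ))).det

/-- The Schur polynomial `s_l(x_1,…,x_n)`: the (unique, since `ℤ[x]` is a domain
and the Vandermonde determinant is nonzero) quotient of the alternant by the
Vandermonde determinant, when the latter divides the former. -/
noncomputable def schur (n : ℕ) (l : ℕ → ℕ) : MvPolynomial (Fin n) ℤ :=
  if h : ∃ q : MvPolynomial (Fin n) ℤ, q * vandermondeP n = alternant n l then h.choose else 0

/-- The Littlewood–Richardson coefficient `c^ν_{λμ}`: the coefficient of `s_ν` in the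
Schur-basis expansion of `s_λ · s_μ` in `|λ| + |μ|` variables, extracted as the
coefficient of the dominant monomial `x^{ν+ρ}` in `s_λ · s_μ · (Vandermonde)`.
It is zero unless `|ν| = |λ| + |μ|`. -/
noncomputable def lrCoeff (l m ν : Partn) : ℤ :=
  if ν.weight = l.weight + m.weight then
    MvPolynomial.coeff
      (Finsupp.equivFunOnFinite.symm fun j : Fin (l.weight + m.weight) =>
        ν.parts (j : ℕ) + (l.weight + m.weight - 1 - (j : ℕ)))
      (schur (l.weight + m.weight) l.parts * schur (l.weight + m.weight) m.parts *
        vandermondeP (l.weight + m.weight))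
  else 0

open Finset in
/-- Signed sum over permutations (Jacobi-Trudi type). -/
noncomputable def JJ {M : Type*} [AddCommGroup M] (n : ℕ) (κ : ℕ → ℕ)
    (Φ : (Fin n → ℕ) → M) : M :=
  ∑ w : Equiv.Perm (Fin n), ((Equiv.Perm.sign w : ℤˣ) : ℤ) •
    if ∀ i : Fin n, (i : ℕ) ≤ κ i + (w i : ℕ) then Φ (fun i => κ i + (w i : ℕ) - (i : ℕ)) else 0

noncomputable def hS {R : Type*} [CommRing R] {n : ℕ} (H : PowerSeries R) (β : Fin n → ℕ) : R :=
  ∏ i, PowerSeries.coeff (β i) H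

noncomputable def JT {R : Type*} [CommRing R] (n : ℕ) (κ : ℕ → ℕ) (H : PowerSeries R) : R :=
  JJ n κ (hS H)

noncomputable def HX (n : ℕ) : PowerSeries (MvPolynomial (Fin n) ℤ) :=
  ∏ i, PowerSeries.mk (fun k => (X i : MvPolynomial (Fin n) ℤ) ^ k)

noncomputable def SS (n : ℕ) (κ : ℕ → ℕ) : MvPolynomial (Fin n) ℤ := JT n κ (HX n)

noncomputable def coef {n : ℕ} (β : Fin n → ℕ) : MvPolynomial (Fin n) ℤ →ₗ[ℤ] ℤ :=
  MvPolynomial.lcoeff ℤ (Finsupp.equivFunOnFinite.symm β)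

theorem coef_apply {n : ℕ} (β : Fin n → ℕ) (f : MvPolynomial (Fin n) ℤ) :
    coef β f = MvPolynomial.coeff (Finsupp.equivFunOnFinite.symm β) f := rfl

theorem map_JJ {M M' F : Type*} [AddCommGroup M] [AddCommGroup M'] [FunLike F M M']
    [AddMonoidHomClass F M M'] (g : F) (n : ℕ) (κ : ℕ → ℕ) (Φ : (Fin n → ℕ) → M) :
    g (JJ n κ Φ) = JJ n κ (fun β => g (Φ β)) := by
  unfold JJ
  rw [map_sum]
  refine Finset.sum_congr rfl fun w _ => ?_
  rw [map_zsmul]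
  split_ifs <;> simp

theorem map_hS {R R' : Type*} [CommRing R] [CommRing R'] (g : R →+* R') {n : ℕ}
    (H : PowerSeries R) (β : Fin n → ℕ) : g (hS H β) = hS (PowerSeries.map g H) β := by
  simp [hS, map_prod]

theorem map_JT {R R' : Type*} [CommRing R] [CommRing R'] (g : R →+* R') (n : ℕ) (κ : ℕ → ℕ)
    (H : PowerSeries R) : g (JT n κ H) = JT n κ (PowerSeries.map g H) := by
  unfold JT
  rw [map_JJ]
  simp only [map_hS]

/-- In `JJ`, only exponents with the right total weight matter. -/
theorem JJ_congr {M : Type*} [AddCommGroup M] (n : ℕ) (κ : ℕ → ℕ)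
    (Φ Ψ : (Fin n → ℕ) → M)
    (h : ∀ β : Fin n → ℕ, ∑ i, β i = ∑ i : Fin n, κ i → Φ β = Ψ β) : JJ n κ Φ = JJ n κ Ψ := by
  unfold JJ
  refine Finset.sum_congr rfl fun w _ => ?_
  split_ifs with hw
  · rw [h]
    have h1 : ∑ i : Fin n, (κ i + (w i : ℕ) - (i : ℕ)) + ∑ i : Fin n, (i : ℕ)
        = ∑ i : Fin n, κ i + ∑ i : Fin n, (i : ℕ) := by
      rw [← Finset.sum_add_distrib]
      conv_rhs => rw [← Equiv.sum_comp w (fun i : Fin n => (i : ℕ)), ← Finset.sum_add_distrib]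
      refine Finset.sum_congr rfl fun i _ => ?_
      have := hw i
      omega
    omega
  · rfl

theorem JJ_sum {M ι : Type*} [AddCommGroup M] (n : ℕ) (κ : ℕ → ℕ) (s : Finset ι)
    (Φ : ι → (Fin n → ℕ) → M) :
    JJ n κ (fun β => ∑ a ∈ s, Φ a β) = ∑ a ∈ s, JJ n κ (Φ a) := by
  unfold JJ
  rw [Finset.sum_comm]
  refine Finset.sum_congr rfl fun w _ => ?_
  rw [← Finset.smul_sum]
  split_ifs <;> simp

theorem JJ_smul {R : Type*} [CommRing R] (n : ℕ) (κ : ℕ → ℕ) (r : R)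
    (Φ : (Fin n → ℕ) → ℤ) :
    JJ n κ (fun β => (Φ β) • r) = (JJ n κ Φ) • r := by
  unfold JJ
  rw [Finset.sum_smul]
  refine Finset.sum_congr rfl fun w _ => ?_
  split_ifs <;> simp [mul_smul]

theorem JJ_succ {M : Type*} [AddCommGroup M] (n : ℕ) (κ : ℕ → ℕ) (hκ : κ n = 0)
    (Φ : (Fin (n+1) → ℕ) → M) :
    JJ (n+1) κ Φ = JJ n κ (fun β => Φ (Fin.snoc β 0)) := by
  unfold JJ
  let E : Option (Fin n) × Equiv.Perm (Fin n) ≃ Equiv.Perm (Fin (n+1)) :=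
    Equiv.Perm.decomposeOption.symm.trans (finSuccEquivLast.symm.permCongr)
  rw [← Equiv.sum_comp E, Fintype.sum_prod_type, Fintype.sum_option]
  have hz : ∑ i : Fin n, ∑ y : Equiv.Perm (Fin n),
      ((Equiv.Perm.sign (E (some i, y)) : ℤˣ) : ℤ) •
        (if ∀ j : Fin (n+1), (j : ℕ) ≤ κ j + (E (some i, y) j : ℕ) then
          Φ (fun j => κ j + (E (some i, y) j : ℕ) - (j : ℕ)) else 0) = 0 := by
    refine Finset.sum_eq_zero fun i _ => Finset.sum_eq_zero fun y _ => ?_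
    rw [if_neg, smul_zero]
    intro h
    have h1 := h (Fin.last n)
    have h2 : E (some i, y) (Fin.last n) = i.castSucc := by
      simp [E, Equiv.permCongr_apply]
    rw [h2] at h1
    simp [hκ] at h1
    have := i.2
    omega
  rw [hz, add_zero]
  refine Finset.sum_congr rfl fun w _ => ?_
  have hs : Equiv.Perm.sign (E (none, w)) = Equiv.Perm.sign w := by
    simp [E]
  have hl : E (none, w) (Fin.last n) = Fin.last n := by
    simp [E, Equiv.permCongr_apply]
  have hc : ∀ i : Fin n, E (none, w) i.castSucc = (w i).castSucc := by
    intro i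
    simp [E, Equiv.permCongr_apply]
  rw [hs]
  congr 1
  have hiff : (∀ j : Fin (n+1), (j : ℕ) ≤ κ j + (E (none, w) j : ℕ)) ↔
      ∀ i : Fin n, (i : ℕ) ≤ κ i + (w i : ℕ) := by
    rw [Fin.forall_fin_succ']
    simp only [hc, hl]
    simp
  simp only [hiff]
  split_ifs with h
  · congr 1
    funext j
    refine Fin.lastCases ?_ (fun i => ?_) j
    · rw [hl]; simp [hκ]
    · rw [hc]; simp
  · rfl

theorem coef_mul_vander (n : ℕ) (κ : ℕ → ℕ) (f : MvPolynomial (Fin n) ℤ) :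
    coef (fun j : Fin n => κ j + (n - 1 - (j : ℕ))) (f * vandermondeP n)
      = JJ n κ (fun β => coef β f) := by
  unfold vandermondeP JJ
  rw [← Matrix.det_transpose, Matrix.det_apply, Finset.mul_sum, map_sum]
  refine Finset.sum_congr rfl fun w _ => ?_
  have h1 : ∏ i : Fin n, (Matrix.of fun i j : Fin n =>
      (X i : MvPolynomial (Fin n) ℤ) ^ (n - 1 - (j : ℕ))).transpose (w i) i
      = monomial (Finsupp.equivFunOnFinite.symm fun i : Fin n => n - 1 - (w i : ℕ)) 1 := by
    rw [MvPolynomial.monomial_eq]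
    simp [Finsupp.prod_fintype]
  rw [h1, mul_smul_comm, Units.smul_def, map_zsmul, coef_apply, coeff_mul_monomial']
  congr 1
  have h2 : (Finsupp.equivFunOnFinite.symm fun i : Fin n => n - 1 - (w i : ℕ)) ≤
      (Finsupp.equivFunOnFinite.symm fun j : Fin n => κ j + (n - 1 - (j : ℕ))) ↔
      ∀ i : Fin n, (i : ℕ) ≤ κ i + (w i : ℕ) := by
    rw [Finsupp.le_def]
    refine forall_congr' fun i => ?_
    have := (w i).2
    have := i.2
    simp only [Finsupp.equivFunOnFinite_symm_apply_apply]
    omega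
  simp only [h2]
  split_ifs with h
  · rw [mul_one, coef_apply]
    congr 1
    ext i
    have := (w i).2
    have := i.2
    have := h i
    simp only [Finsupp.coe_tsub, Pi.sub_apply, Finsupp.equivFunOnFinite_symm_apply_apply]
    omega
  · rfl

theorem coeff_HX (n k : ℕ) : PowerSeries.coeff k (HX n) =
    ∑ m ∈ Finset.finsuppAntidiag (Finset.univ : Finset (Fin n)) k,
      (monomial m 1 : MvPolynomial (Fin n) ℤ) := by
  unfold HX
  rw [PowerSeries.coeff_prod]
  refine Finset.sum_congr (by congr) fun m _ => ?_
  rw [MvPolynomial.monomial_eq]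
  simp [Finsupp.prod_fintype]

theorem coeff_zero_HX (n : ℕ) : PowerSeries.coeff 0 (HX n) = 1 := by
  rw [coeff_HX]
  simp

theorem hS_HX (n N : ℕ) (β : Fin N → ℕ) : hS (HX n) β =
    ∑ p ∈ Fintype.piFinset (fun j => Finset.finsuppAntidiag (Finset.univ : Finset (Fin n)) (β j)),
      (monomial (∑ j, p j) 1 : MvPolynomial (Fin n) ℤ) := by
  unfold hS
  simp only [coeff_HX]
  rw [Finset.prod_univ_sum]
  refine Finset.sum_congr rfl fun p _ => ?_
  exact (MvPolynomial.monomial_sum_one _ _).symm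

theorem coef_hS_symm (n N : ℕ) (α : Fin n → ℕ) (β : Fin N → ℕ) :
    coef α (hS (HX n) β) = coef β (hS (HX N) α) := by
  rw [hS_HX, hS_HX, map_sum, map_sum]
  simp only [coef_apply, coeff_monomial]
  rw [← Finset.sum_filter, ← Finset.sum_filter]
  refine Finset.sum_bij' (fun p _ => fun i => Finsupp.equivFunOnFinite.symm fun j => p j i)
    (fun p _ => fun i => Finsupp.equivFunOnFinite.symm fun j => p j i) ?_ ?_ ?_ ?_ ?_
  · intro p hp
    simp only [Finset.mem_filter, Fintype.mem_piFinset, Finset.mem_finsuppAntidiag] at hp ⊢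
    obtain ⟨h1, h2⟩ := hp
    refine ⟨fun i => ⟨?_, Finset.subset_univ _⟩, ?_⟩
    · have := DFunLike.congr_fun h2 i
      simpa [Finsupp.finsetSum_apply] using this
    · ext j
      simpa [Finsupp.finsetSum_apply] using (h1 j).1
  · intro p hp
    simp only [Finset.mem_filter, Fintype.mem_piFinset, Finset.mem_finsuppAntidiag] at hp ⊢
    obtain ⟨h1, h2⟩ := hp
    refine ⟨fun i => ⟨?_, Finset.subset_univ _⟩, ?_⟩
    · have := DFunLike.congr_fun h2 i
      simpa [Finsupp.finsetSum_apply] using this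
    · ext j
      simpa [Finsupp.finsetSum_apply] using (h1 j).1
  · intro p _
    funext i
    ext j
    simp
  · intro p _
    funext i
    ext j
    simp
  · intro p _
    rfl

/-- Duality of coefficients. -/
theorem JJ_dual (n N : ℕ) (σ : ℕ → ℕ) (β : Fin N → ℕ) :
    JJ n σ (fun α => coef α (hS (HX n) β)) = coef β (JT n σ (HX N)) := by
  unfold JT
  rw [map_JJ]
  simp only [coef_hS_symm n N]

theorem hS_snoc {R : Type*} [CommRing R] {n : ℕ} (H : PowerSeries R)
    (h0 : PowerSeries.coeff 0 H = 1) (β : Fin n → ℕ) :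
    hS H (Fin.snoc β 0 : Fin (n+1) → ℕ) = hS H β := by
  unfold hS
  rw [Fin.prod_univ_castSucc]
  simp only [Fin.snoc_castSucc, Fin.snoc_last, h0, mul_one]

theorem JT_succ {R : Type*} [CommRing R] (n : ℕ) (κ : ℕ → ℕ) (hκ : κ n = 0) (H : PowerSeries R)
    (h0 : PowerSeries.coeff 0 H = 1) : JT (n+1) κ H = JT n κ H := by
  unfold JT
  rw [JJ_succ _ _ hκ]
  simp only [hS_snoc H h0]

theorem JT_stable {R : Type*} [CommRing R] (n N : ℕ) (hnN : n ≤ N) (κ : ℕ → ℕ)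
    (hκ : ∀ i, n ≤ i → κ i = 0) (H : PowerSeries R)
    (h0 : PowerSeries.coeff 0 H = 1) : JT N κ H = JT n κ H := by
  induction N, hnN using Nat.le_induction with
  | base => rfl
  | succ m hm ih => rw [JT_succ m κ (hκ m hm) H h0, ih]

noncomputable def kill (n : ℕ) : MvPolynomial (Fin (n+1)) ℤ →ₐ[ℤ] MvPolynomial (Fin n) ℤ :=
  MvPolynomial.killCompl (Fin.castSucc_injective n)

theorem coef_kill (n : ℕ) (β : Fin n → ℕ) (f : MvPolynomial (Fin (n+1)) ℤ) :
    coef β (kill n f) = coef (Fin.snoc β 0 : Fin (n+1) → ℕ) f := by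
  unfold kill
  rw [coef_apply, coef_apply, coeff_killCompl]
  congr 1
  ext j
  refine Fin.lastCases ?_ (fun i => ?_) j
  · rw [Finsupp.mapDomain_of_notMem_range]
    · simp
    · simp
  · rw [Finsupp.mapDomain_apply (Fin.castSucc_injective n)]
    simp

theorem map_HX {R : Type*} [CommRing R] (n : ℕ) (g : MvPolynomial (Fin n) ℤ →+* R) :
    PowerSeries.map g (HX n) = ∏ i, PowerSeries.mk (fun k => g (X i) ^ k) := by
  unfold HX
  rw [map_prod]
  refine Finset.prod_congr rfl fun i _ => ?_
  ext k
  simp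

theorem kill_HX (n : ℕ) : PowerSeries.map (kill n : MvPolynomial (Fin (n+1)) ℤ →+* _) (HX (n+1))
    = HX n := by
  rw [map_HX, Fin.prod_univ_castSucc]
  have h1 : kill n (X (Fin.last n)) = 0 := by
    simp [kill, killCompl]
  have h2 : ∀ i : Fin n, kill n (X i.castSucc) = X i := by
    intro i
    unfold kill
    rw [← rename_X (R := ℤ) Fin.castSucc i, killCompl_rename_app]
  have h3 : (PowerSeries.mk (fun k => ((0 : MvPolynomial (Fin n) ℤ)) ^ k)) = 1 := by
    ext k
    simp [PowerSeries.coeff_one, zero_pow_eq]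
  simp only [RingHom.coe_coe, h1, h2, h3, mul_one]
  rfl

theorem kill_SS (n : ℕ) (κ : ℕ → ℕ) (hκ : κ n = 0) : kill n (SS (n+1) κ) = SS n κ := by
  unfold SS
  have := map_JT (kill n : MvPolynomial (Fin (n+1)) ℤ →+* MvPolynomial (Fin n) ℤ) (n+1) κ (HX (n+1))
  rw [kill_HX, JT_succ n κ hκ _ (coeff_zero_HX n)] at this
  exact this

theorem lr_succ (n : ℕ) (l m ν : ℕ → ℕ) (hl : l n = 0) (hm : m n = 0) (hν : ν n = 0) :
    JJ (n+1) ν (fun β => coef β (SS (n+1) l * SS (n+1) m)) =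
      JJ n ν (fun β => coef β (SS n l * SS n m)) := by
  rw [JJ_succ _ _ hν]
  simp only [← coef_kill, map_mul, kill_SS _ _ hl, kill_SS _ _ hm]

theorem lr_stable (n N : ℕ) (hnN : n ≤ N) (l m ν : ℕ → ℕ) (hl : ∀ i, n ≤ i → l i = 0)
    (hm : ∀ i, n ≤ i → m i = 0) (hν : ∀ i, n ≤ i → ν i = 0) :
    JJ N ν (fun β => coef β (SS N l * SS N m)) =
      JJ n ν (fun β => coef β (SS n l * SS n m)) := by
  induction N, hnN using Nat.le_induction with
  | base => rfl
  | succ k hk ih => rw [lr_succ k l m ν (hl k hk) (hm k hk) (hν k hk), ih]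

/-- Homogeneity. -/
theorem homog_coeff_HX (n k : ℕ) : (PowerSeries.coeff k (HX n)).IsHomogeneous k := by
  rw [coeff_HX]
  refine IsHomogeneous.sum _ _ _ fun m hm => ?_
  apply isHomogeneous_monomial
  rw [Finset.mem_finsuppAntidiag] at hm
  rw [← hm.1, Finsupp.degree_eq_sum]

theorem homog_hS (n N : ℕ) (β : Fin N → ℕ) : (hS (HX n) β).IsHomogeneous (∑ i, β i) := by
  unfold hS
  exact IsHomogeneous.prod _ _ _ fun i _ => homog_coeff_HX n _

theorem homog_JT (n N : ℕ) (κ : ℕ → ℕ) :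
    (JT n κ (HX N)).IsHomogeneous (∑ i : Fin n, κ i) := by
  unfold JT
  have : JJ n κ (hS (HX N)) = JJ n κ (fun β => homogeneousComponent (∑ i : Fin n, κ i)
      (hS (HX N) β)) := by
    apply JJ_congr
    intro β hβ
    rw [homogeneousComponent_of_mem (homog_hS N n β), if_pos hβ.symm]
  rw [this, ← map_JJ]
  apply homogeneousComponent_isHomogeneous

/-- Symmetry. -/
theorem symm_HX (n : ℕ) (e : Equiv.Perm (Fin n)) :
    PowerSeries.map (rename e : MvPolynomial (Fin n) ℤ →ₐ[ℤ] _).toRingHom (HX n) = HX n := by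
  rw [map_HX]
  simp only [AlgHom.toRingHom_eq_coe, RingHom.coe_coe, rename_X]
  unfold HX
  exact Equiv.prod_comp e (fun i => PowerSeries.mk (fun k => (X i : MvPolynomial (Fin n) ℤ) ^ k))

theorem symm_hS (n N : ℕ) (β : Fin N → ℕ) : (hS (HX n) β).IsSymmetric := by
  intro e
  have := map_hS (rename e : MvPolynomial (Fin n) ℤ →ₐ[ℤ] _).toRingHom (HX n) β
  rw [symm_HX] at this
  exact this

theorem symm_JT (n N : ℕ) (κ : ℕ → ℕ) : (JT N κ (HX n)).IsSymmetric := by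
  intro e
  have := map_JT (rename e : MvPolynomial (Fin n) ℤ →ₐ[ℤ] _).toRingHom N κ (HX n)
  rw [symm_HX] at this
  exact this

noncomputable def PE (n : ℕ) (i : Fin n) : Polynomial (MvPolynomial (Fin n) ℤ) :=
  ∏ j ∈ Finset.univ.erase i, (1 - Polynomial.C (X j) * Polynomial.X)

theorem natDegree_PE (n : ℕ) (i : Fin n) : (PE n i).natDegree < n := by
  unfold PE
  have h1 : ∀ j ∈ Finset.univ.erase i,
      (1 - Polynomial.C (X j : MvPolynomial (Fin n) ℤ) * Polynomial.X).natDegree ≤ 1 := by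
    intro j _
    compute_degree
  have h2 := (Polynomial.natDegree_prod_le (Finset.univ.erase i)
    (fun j => (1 - Polynomial.C (X j : MvPolynomial (Fin n) ℤ) * Polynomial.X))).trans
      (Finset.sum_le_sum h1)
  rw [Finset.sum_const, Finset.card_erase_of_mem (Finset.mem_univ _), Finset.card_univ,
    Fintype.card_fin, smul_eq_mul, mul_one] at h2
  have := i.2
  omega

theorem HX_mul_PE (n : ℕ) (i : Fin n) :
    HX n * (PE n i : PowerSeries (MvPolynomial (Fin n) ℤ)) = PowerSeries.mk (fun k => X i ^ k) := by
  unfold HX PE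
  rw [← Finset.mul_prod_erase _ _ (Finset.mem_univ i)]
  have : ((∏ j ∈ Finset.univ.erase i,
      (1 - Polynomial.C (X j : MvPolynomial (Fin n) ℤ) * Polynomial.X) :
        Polynomial (MvPolynomial (Fin n) ℤ)) : PowerSeries (MvPolynomial (Fin n) ℤ)) =
      ∏ j ∈ Finset.univ.erase i, (1 - PowerSeries.C (X j) * PowerSeries.X) := by
    rw [← Polynomial.coeToPowerSeries.ringHom_apply, map_prod]
    refine Finset.prod_congr rfl fun j _ => ?_
    simp
  rw [this, mul_assoc, ← Finset.prod_mul_distrib, Finset.prod_eq_one, mul_one]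
  intro j _
  ext k
  rw [mul_sub, mul_one, map_sub, mul_comm (PowerSeries.C _), ← mul_assoc]
  cases k with
  | zero => simp
  | succ k => simp [PowerSeries.coeff_succ_mul_X, PowerSeries.coeff_one, pow_succ]

theorem pow_expand (n m : ℕ) (i : Fin n) :
    (X i : MvPolynomial (Fin n) ℤ) ^ m = ∑ k : Fin n, (PE n i).coeff (n - 1 - (k : ℕ)) *
      (if n - 1 - (k : ℕ) ≤ m then PowerSeries.coeff (m - (n - 1 - (k : ℕ))) (HX n) else 0) := by
  have h1 := congrArg (PowerSeries.coeff m) (HX_mul_PE n i)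
  rw [PowerSeries.coeff_mk] at h1
  rw [← h1]
  conv_lhs => rw [(PE n i).as_sum_range' n (natDegree_PE n i)]
  rw [← Polynomial.coeToPowerSeries.ringHom_apply, map_sum, Finset.mul_sum, map_sum]
  rw [Finset.sum_range (n := n), ← Equiv.sum_comp Fin.revPerm]
  refine Finset.sum_congr rfl fun k _ => ?_
  have hk : ((Fin.revPerm k : Fin n) : ℕ) = n - 1 - (k : ℕ) := by
    simp [Fin.val_rev]; omega
  rw [hk]
  generalize n - 1 - (k : ℕ) = b
  rw [Polynomial.coeToPowerSeries.ringHom_apply, ← Polynomial.C_mul_X_pow_eq_monomial,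
    Polynomial.coe_mul, Polynomial.coe_C, Polynomial.coe_pow, Polynomial.coe_X,
    mul_left_comm, PowerSeries.coeff_C_mul, PowerSeries.coeff_mul_X_pow']

noncomputable def HM (n : ℕ) (κ : ℕ → ℕ) : Matrix (Fin n) (Fin n) (MvPolynomial (Fin n) ℤ) :=
  Matrix.of fun k j => if (j : ℕ) ≤ κ j + (k : ℕ) then
    PowerSeries.coeff (κ j + (k : ℕ) - (j : ℕ)) (HX n) else 0

theorem det_HM (n : ℕ) (κ : ℕ → ℕ) : (HM n κ).det = SS n κ := by
  unfold SS JT JJ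
  rw [Matrix.det_apply]
  refine Finset.sum_congr rfl fun w _ => ?_
  rw [Units.smul_def]
  congr 1
  unfold HM hS
  simp only [Matrix.of_apply]
  split_ifs with h
  · exact Finset.prod_congr rfl fun i _ => if_pos (h i)
  · push Not at h
    obtain ⟨i, hi⟩ := h
    exact Finset.prod_eq_zero (Finset.mem_univ i) (if_neg (by omega))

theorem alternant_eq (n : ℕ) (κ : ℕ → ℕ) :
    alternant n κ = (Matrix.of fun i k : Fin n => (PE n i).coeff (n - 1 - (k : ℕ))).det * SS n κ := by
  rw [← det_HM, ← Matrix.det_mul]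
  unfold alternant
  congr 1
  ext1 i j
  rw [Matrix.mul_apply]
  simp only [Matrix.of_apply]
  rw [pow_expand]
  refine Finset.sum_congr rfl fun k _ => ?_
  congr 1
  simp only [HM, Matrix.of_apply]
  have := k.2
  have := j.2
  by_cases h : (j : ℕ) ≤ κ j + (k : ℕ)
  · rw [if_pos h, if_pos (by omega)]
    congr 2
    omega
  · rw [if_neg h, if_neg (by omega)]

theorem SS_zero (n : ℕ) : SS n (fun _ => 0) = 1 := by
  unfold SS
  rw [JT_stable 0 n (Nat.zero_le _) _ (fun _ _ => rfl) _ (coeff_zero_HX n)]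
  simp [JT, JJ, hS]

theorem vander_eq (n : ℕ) : vandermondeP n = alternant n (fun _ => 0) := by
  simp [vandermondeP, alternant]

theorem SS_mul_vander (n : ℕ) (κ : ℕ → ℕ) : SS n κ * vandermondeP n = alternant n κ := by
  rw [vander_eq, alternant_eq, alternant_eq n κ, SS_zero]
  ring

theorem strictAnti_aux (n : ℕ) (κ : ℕ → ℕ) (h : ∀ i j, i ≤ j → κ j ≤ κ i) :
    StrictAnti (fun j : Fin n => κ j + (n - 1 - (j : ℕ))) := by
  intro i j hij
  have h1 := h i j (by simpa using hij.le)
  have h2 : (i : ℕ) < j := hij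
  have := j.2
  simp only
  omega

theorem coef_alternant (n : ℕ) (κ κ' : ℕ → ℕ) (h : ∀ i j, i ≤ j → κ j ≤ κ i)
    (h' : ∀ i j, i ≤ j → κ' j ≤ κ' i) :
    coef (fun j : Fin n => κ' j + (n - 1 - (j : ℕ))) (alternant n κ)
      = if ∀ i : Fin n, κ i = κ' i then 1 else 0 := by
  have h0 : ∀ w : Equiv.Perm (Fin n), coef (fun j : Fin n => κ' j + (n - 1 - (j : ℕ)))
      (Equiv.Perm.sign w • ∏ i : Fin n, (Matrix.of fun i j : Fin n =>
      (X i : MvPolynomial (Fin n) ℤ) ^ (κ j + (n - 1 - (j : ℕ)))).transpose (w i) i)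
      = if w = 1 ∧ ∀ i : Fin n, κ i = κ' i then 1 else 0 := by
    intro w
    have h1 : ∏ i : Fin n, (Matrix.of fun i j : Fin n =>
        (X i : MvPolynomial (Fin n) ℤ) ^ (κ j + (n - 1 - (j : ℕ)))).transpose (w i) i
        = monomial (Finsupp.equivFunOnFinite.symm
          fun i : Fin n => κ (w i) + (n - 1 - (w i : ℕ))) 1 := by
      rw [MvPolynomial.monomial_eq]
      simp [Finsupp.prod_fintype]
    rw [h1, Units.smul_def, map_zsmul, coef_apply, coeff_monomial]
    have h2 : (Finsupp.equivFunOnFinite.symm fun i : Fin n => κ (w i) + (n - 1 - (w i : ℕ))) =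
        (Finsupp.equivFunOnFinite.symm fun j : Fin n => κ' j + (n - 1 - (j : ℕ))) ↔
        (w = 1 ∧ ∀ i : Fin n, κ i = κ' i) := by
      rw [Equiv.apply_eq_iff_eq]
      constructor
      · intro he
        have hw : w = 1 := by
          have hm : StrictMono w := by
            intro i j hij
            have h3 := strictAnti_aux n κ' h' hij
            rw [← he] at h3
            exact (strictAnti_aux n κ h).lt_iff_gt.1 h3
          have := (StrictMono.range_inj hm strictMono_id).1
            (by rw [w.surjective.range_eq]; simp)
          ext i
          rw [this]; rfl
        refine ⟨hw, fun i => ?_⟩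
        have := congrFun he i
        subst hw
        simpa using this
      · rintro ⟨rfl, he⟩
        funext i
        simp [he]
    simp only [h2]
    split_ifs with h3
    · simp [h3.1]
    · simp
  unfold alternant
  rw [← Matrix.det_transpose, Matrix.det_apply, map_sum, Finset.sum_congr rfl (fun w _ => h0 w)]
  by_cases h4 : ∀ i : Fin n, κ i = κ' i
  · simp [h4]
  · simp [h4]

theorem vander_ne_zero (n : ℕ) : vandermondeP n ≠ 0 := by
  intro h
  have := coef_alternant n (fun _ => 0) (fun _ => 0) (fun _ _ _ => le_rfl) (fun _ _ _ => le_rfl)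
  rw [← vander_eq, h] at this
  simp at this

theorem schur_eq (n : ℕ) (κ : ℕ → ℕ) : schur n κ = SS n κ := by
  have h : ∃ q : MvPolynomial (Fin n) ℤ, q * vandermondeP n = alternant n κ :=
    ⟨_, SS_mul_vander n κ⟩
  unfold schur
  rw [dif_pos h]
  apply mul_right_cancel₀ (vander_ne_zero n)
  rw [h.choose_spec, SS_mul_vander]

theorem anti_vander (n : ℕ) (e : Equiv.Perm (Fin n)) :
    rename e (vandermondeP n) = ((Equiv.Perm.sign e : ℤˣ) : ℤ) • vandermondeP n := by
  unfold vandermondeP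
  rw [AlgHom.map_det]
  have : (rename (R := ℤ) e).mapMatrix (Matrix.of fun i j : Fin n =>
      (X i : MvPolynomial (Fin n) ℤ) ^ (n - 1 - (j : ℕ))) =
      (Matrix.of fun i j : Fin n =>
      (X i : MvPolynomial (Fin n) ℤ) ^ (n - 1 - (j : ℕ))).submatrix e id := by
    ext1 i j
    simp
  rw [this, Matrix.det_permute]
  simp

theorem coef_perm {n : ℕ} (g : MvPolynomial (Fin n) ℤ)
    (hg : ∀ e : Equiv.Perm (Fin n), rename e g = ((Equiv.Perm.sign e : ℤˣ) : ℤ) • g)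
    (a : Fin n → ℕ) (e : Equiv.Perm (Fin n)) :
    coef a g = ((Equiv.Perm.sign e : ℤˣ) : ℤ) * coef (a ∘ e) g := by
  have h1 := coeff_rename_mapDomain e e.injective g (Finsupp.equivFunOnFinite.symm (a ∘ e))
  have h2 : (Finsupp.equivFunOnFinite.symm (a ∘ e)).mapDomain e
      = Finsupp.equivFunOnFinite.symm a := by
    ext i
    obtain ⟨j, rfl⟩ := e.surjective i
    rw [Finsupp.mapDomain_apply e.injective]
    simp
  rw [h2, hg e, ← coef_apply, ← coef_apply, map_zsmul] at h1
  rw [← h1, smul_eq_mul, ← mul_assoc]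
  have : ((Equiv.Perm.sign e : ℤˣ) : ℤ) * ((Equiv.Perm.sign e : ℤˣ) : ℤ) = 1 := by
    rw [← Units.val_mul, Int.units_mul_self]; rfl
  rw [this, one_mul]

theorem anti_eq_zero {n : ℕ} (g : MvPolynomial (Fin n) ℤ)
    (hg : ∀ e : Equiv.Perm (Fin n), rename e g = ((Equiv.Perm.sign e : ℤˣ) : ℤ) • g)
    (h0 : ∀ a : Fin n → ℕ, StrictAnti a → coef a g = 0) : g = 0 := by
  have key : ∀ a : Fin n → ℕ, coef a g = 0 := by
    intro a
    set e := Tuple.sort (fun i => OrderDual.toDual (a i)) with he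
    have hm : Antitone (a ∘ e) := by
      have := Tuple.monotone_sort (fun i => OrderDual.toDual (a i))
      intro i j hij
      exact this hij
    rw [coef_perm g hg a e]
    by_cases hi : Function.Injective (a ∘ e)
    · rw [h0 _ (hm.strictAnti_of_injective hi), mul_zero]
    · rw [Function.not_injective_iff] at hi
      obtain ⟨i, j, hij, hne⟩ := hi
      have h1 := coef_perm g hg (a ∘ e) (Equiv.swap i j)
      have h2 : (a ∘ e) ∘ (Equiv.swap i j) = a ∘ e := by
        funext k
        simp only [Function.comp_apply] at hij ⊢
        rcases eq_or_ne k i with rfl | hki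
        · rw [Equiv.swap_apply_left, hij]
        · rcases eq_or_ne k j with rfl | hkj
          · rw [Equiv.swap_apply_right, hij]
          · rw [Equiv.swap_apply_of_ne_of_ne hki hkj]
      rw [h2, Equiv.Perm.sign_swap hne] at h1
      have : coef (a ∘ e) g = 0 := by
        simp at h1
        omega
      rw [this, mul_zero]
  ext d
  have := key d
  rw [coef_apply] at this
  simpa using this

theorem weight_eq (p : Partn) (n : ℕ) (h : ∀ i, n ≤ i → p.parts i = 0) :
    p.weight = ∑ i : Fin n, p.parts i := by
  unfold Partn.weight
  rw [finsum_eq_sum_of_support_subset (s := Finset.range n), Finset.sum_range]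
  intro i hi
  simp only [Finset.coe_range, Set.mem_Iio]
  by_contra hn
  exact hi (h i (by omega))

theorem length_le (p : Partn) (n : ℕ) (h : p.weight ≤ n) : ∀ i, n ≤ i → p.parts i = 0 := by
  intro i hi
  by_contra hne
  obtain ⟨N, hN⟩ := p.eventually_zero
  have hN' : ∀ j, (N + i + 1) ≤ j → p.parts j = 0 := fun j hj => hN j (by omega)
  have h1 := weight_eq p (N + i + 1) hN'
  rw [← Finset.sum_range (fun i => p.parts i)] at h1
  have h2 : ∑ j ∈ Finset.range (i+1), 1 ≤ ∑ j ∈ Finset.range (i+1), p.parts j := by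
    refine Finset.sum_le_sum fun j hj => ?_
    have := p.antitone j i (by simp at hj; omega)
    omega
  have h3 : ∑ j ∈ Finset.range (i+1), p.parts j ≤ ∑ j ∈ Finset.range (N+i+1), p.parts j :=
    Finset.sum_le_sum_of_subset (by intro j; simp; omega)
  simp at h2
  omega

theorem parts_le_weight (p : Partn) (i : ℕ) : p.parts i ≤ p.weight := by
  by_cases hi : i < p.weight
  · rw [weight_eq p p.weight (length_le p _ le_rfl)]
    exact Finset.single_le_sum (f := fun j : Fin p.weight => p.parts j) (fun _ _ => Nat.zero_le _)
      (Finset.mem_univ (⟨i, hi⟩ : Fin p.weight))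
  · rw [length_le p _ le_rfl i (by omega)]
    exact Nat.zero_le _

theorem partn_ext (p q : Partn) (h : ∀ i, p.parts i = q.parts i) : p = q := by
  cases p; cases q
  simp only [Partn.mk.injEq]
  exact funext h

theorem finite_weight (D : ℕ) : {p : Partn | p.weight ≤ D}.Finite := by
  refine Set.Finite.of_injOn (f := fun p : Partn => fun i : Fin D => p.parts i)
    (t := Set.pi Set.univ (fun _ => Set.Iic D)) ?_ ?_ ?_
  · intro p hp i _
    exact (parts_le_weight p i).trans hp
  · intro p hp q hq hpq
    apply partn_ext
    intro i
    by_cases hi : i < D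
    · exact congrFun hpq ⟨i, hi⟩
    · rw [length_le p D hp i (by omega), length_le q D hq i (by omega)]
  · exact Set.Finite.pi' (fun _ => Set.finite_Iic D) |>.subset (by intro f hf i; exact hf i trivial)

noncomputable def FP (D : ℕ) : Finset Partn := (finite_weight D).toFinset

theorem mem_FP (D : ℕ) (p : Partn) : p ∈ FP D ↔ p.weight ≤ D := by
  simp [FP]

/-- strictly decreasing exponents come from partitions -/
theorem exists_partn (n : ℕ) (a : Fin n → ℕ) (ha : StrictAnti a) :
    ∃ κ : Partn, (∀ i, n ≤ i → κ.parts i = 0) ∧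
      a = fun j : Fin n => κ.parts j + (n - 1 - (j : ℕ)) := by
  have h1 : ∀ k : ℕ, ∀ i j : Fin n, (j : ℕ) = i + k → a j + k ≤ a i := by
    intro k
    induction k with
    | zero =>
      intro i j hij
      have : j = i := Fin.ext (by simpa using hij)
      subst this; simp
    | succ k ih =>
      intro i j hij
      have hj := j.2
      have h2 := ih i ⟨i + k, by omega⟩ rfl
      have h3 : a j < a ⟨i + k, by omega⟩ := ha (by rw [Fin.lt_def]; simp; omega)
      omega
  have h2 : ∀ i : Fin n, n - 1 - (i : ℕ) ≤ a i := by
    intro i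
    have hi := i.2
    have := h1 (n - 1 - i) i ⟨n - 1, by omega⟩ (by simp; omega)
    omega
  refine ⟨⟨fun i => if h : i < n then a ⟨i, h⟩ - (n - 1 - i) else 0, ?_, n, ?_⟩, ?_, ?_⟩
  · intro i j hij
    by_cases hj : j < n
    · have hi : i < n := by omega
      simp only [hi, hj, dif_pos]
      have := h1 (j - i) ⟨i, hi⟩ ⟨j, hj⟩ (by simp; omega)
      have := h2 ⟨j, hj⟩
      simp only at this
      omega
    · simp [hj]
  · intro i hi
    simp [Nat.not_lt.2 hi]
  · intro i hi
    simp [Nat.not_lt.2 hi]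
  · funext j
    have := h2 j
    simp
    omega

theorem JJ_homog_zero (n : ℕ) (κ : ℕ → ℕ) (f : MvPolynomial (Fin n) ℤ) (d : ℕ)
    (hf : f.IsHomogeneous d) (hd : ∑ i : Fin n, κ i ≠ d) : JJ n κ (fun β => coef β f) = 0 := by
  have : JJ n κ (fun β => coef β f) = JJ n κ (fun β => (0 : ℤ)) := by
    apply JJ_congr
    intro β hβ
    rw [coef_apply]
    apply hf.coeff_eq_zero
    rw [Finsupp.degree_eq_sum]
    simpa [hβ] using hd
  rw [this]
  simp [JJ]

theorem JJ_SS (n : ℕ) (κ κ' : Partn) (h : κ.weight ≤ n) (h' : ∀ i, n ≤ i → κ'.parts i = 0) :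
    JJ n κ'.parts (fun β => coef β (SS n κ.parts)) = if κ = κ' then 1 else 0 := by
  rw [← coef_mul_vander, SS_mul_vander, coef_alternant n _ _ κ.antitone κ'.antitone]
  have : (∀ i : Fin n, κ.parts i = κ'.parts i) ↔ κ = κ' := by
    constructor
    · intro hh
      apply partn_ext
      intro i
      by_cases hi : i < n
      · exact hh ⟨i, hi⟩
      · rw [length_le κ n h i (by omega), h' i (by omega)]
    · rintro rfl i
      rfl
  simp only [this]

theorem expansion (n D d : ℕ) (hd : d ≤ D) (hD : D ≤ n) (f : MvPolynomial (Fin n) ℤ)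
    (hs : f.IsSymmetric) (hf : f.IsHomogeneous d) :
    f = ∑ κ ∈ FP D, (JJ n κ.parts (fun β => coef β f)) • SS n κ.parts := by
  rw [← sub_eq_zero]
  apply (mul_eq_zero.1 _).resolve_right (vander_ne_zero n)
  apply anti_eq_zero
  · intro e
    rw [map_mul, anti_vander, mul_smul_comm]
    congr 2
    rw [map_sub, hs e, map_sum]
    congr 1
    refine Finset.sum_congr rfl fun κ _ => ?_
    rw [map_zsmul]
    congr 1
    exact symm_JT n n _ e
  · intro a ha
    obtain ⟨κ', hκ', rfl⟩ := exists_partn n a ha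
    rw [coef_mul_vander]
    have h1 : ∀ β : Fin n → ℕ, coef β (f - ∑ κ ∈ FP D, (JJ n κ.parts (fun β => coef β f)) • SS n κ.parts)
        = coef β f - ∑ κ ∈ FP D, (JJ n κ.parts (fun β => coef β f)) * coef β (SS n κ.parts) := by
      intro β
      rw [map_sub, map_sum]
      simp only [map_zsmul, smul_eq_mul]
    rw [← coef_mul_vander, sub_mul, map_sub, Finset.sum_mul, map_sum]
    simp only [smul_mul_assoc, map_zsmul, coef_mul_vander]
    have h2 : ∀ κ ∈ FP D, JJ n κ.parts (fun β => coef β f) •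
        JJ n κ'.parts (fun β => coef β (SS n κ.parts)) =
        if κ = κ' then JJ n κ'.parts (fun β => coef β f) else 0 := by
      intro κ hκ
      rw [mem_FP] at hκ
      rw [JJ_SS n κ κ' (hκ.trans hD) hκ']
      split_ifs with h
      · simp [h]
      · simp
    rw [Finset.sum_congr rfl h2, Finset.sum_ite_eq']
    split_ifs with h
    · simp
    · rw [sub_zero]
      apply JJ_homog_zero n _ f d hf
      rw [mem_FP] at h
      rw [← weight_eq κ' n hκ']
      omega

theorem homog_SS (n : ℕ) (l : Partn) (hl : l.weight ≤ n) :
    (SS n l.parts).IsHomogeneous l.weight := by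
  rw [weight_eq l n (length_le l n hl)]
  exact homog_JT n n _

theorem lrCoeff_eq (n : ℕ) (l m ν : Partn) (hl : l.weight ≤ n) (hm : m.weight ≤ n)
    (hν : ν.weight ≤ n) :
    lrCoeff l m ν = JJ n ν.parts (fun β => coef β (SS n l.parts * SS n m.parts)) := by
  unfold lrCoeff
  split_ifs with h
  · rw [lr_stable (l.weight + m.weight) n (by omega) _ _ _ (length_le l _ (by omega))
      (length_le m _ (by omega)) (length_le ν _ (by omega)), schur_eq, schur_eq,
      ← coef_mul_vander]
    rfl
  · symm
    apply JJ_homog_zero n _ _ (l.weight + m.weight) ((homog_SS n l hl).mul (homog_SS n m hm))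
    rwa [← weight_eq ν n (length_le ν n hν)]

theorem lrCoeff_zero (l m ν : Partn) (h : ν.weight ≠ l.weight + m.weight) : lrCoeff l m ν = 0 := by
  unfold lrCoeff
  rw [if_neg h]

theorem prod_rule (n D : ℕ) (hD : D ≤ n) (μ ν : Partn) (h : μ.weight + ν.weight ≤ D) :
    SS n μ.parts * SS n ν.parts = ∑ κ ∈ FP D, lrCoeff μ ν κ • SS n κ.parts := by
  have hs : (SS n μ.parts * SS n ν.parts).IsSymmetric :=
    IsSymmetric.mul (symm_JT n n μ.parts) (symm_JT n n ν.parts)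
  conv_lhs => rw [expansion n D _ h hD _ hs
    ((homog_SS n μ (by omega)).mul (homog_SS n ν (by omega)))]
  refine Finset.sum_congr rfl fun κ hκ => ?_
  rw [mem_FP] at hκ
  rw [lrCoeff_eq n μ ν κ (by omega) (by omega) (by omega)]

theorem cauchy (n : ℕ) (β : Fin n → ℕ) (h : ∑ i, β i ≤ n) :
    hS (HX n) β = ∑ σ ∈ FP n, coef β (SS n σ.parts) • SS n σ.parts := by
  conv_lhs => rw [expansion n n _ h le_rfl _ (symm_hS n n β) (homog_hS n n β)]
  refine Finset.sum_congr rfl fun σ _ => ?_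
  rw [JJ_dual]
  rfl

theorem coef_mul {n : ℕ} (f g : MvPolynomial (Fin n) ℤ) (β : Fin n → ℕ) :
    coef β (f * g) = ∑ p ∈ Finset.HasAntidiagonal.antidiagonal (Finsupp.equivFunOnFinite.symm β),
      coef p.1 f * coef p.2 g := by
  rw [coef_apply, coeff_mul]
  refine Finset.sum_congr rfl fun p _ => ?_
  simp [coef_apply]

theorem hS_mul {R : Type*} [CommRing R] {n : ℕ} (H1 H2 : PowerSeries R) (β : Fin n → ℕ) :
    hS (H1 * H2) β = ∑ p ∈ Finset.HasAntidiagonal.antidiagonal (Finsupp.equivFunOnFinite.symm β),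
      hS H1 p.1 * hS H2 p.2 := by
  unfold hS
  simp only [PowerSeries.coeff_mul]
  rw [Finset.prod_univ_sum]
  simp only [← Finset.prod_mul_distrib]
  refine Finset.sum_bij' (fun q _ => (Finsupp.equivFunOnFinite.symm fun i => (q i).1,
      Finsupp.equivFunOnFinite.symm fun i => (q i).2))
    (fun p _ => fun i => (p.1 i, p.2 i)) ?_ ?_ ?_ ?_ ?_
  · intro q hq
    simp only [Fintype.mem_piFinset, Finset.HasAntidiagonal.mem_antidiagonal] at hq ⊢
    ext i
    simpa using hq i
  · intro p hp
    simp only [Fintype.mem_piFinset, Finset.HasAntidiagonal.mem_antidiagonal] at hp ⊢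
    intro i
    simpa using DFunLike.congr_fun hp i
  · intro q _
    simp
  · intro p _
    ext <;> simp
  · intro q _
    simp

theorem coproduct {R : Type*} [CommRing R] (n : ℕ) (φ ψ : MvPolynomial (Fin n) ℤ →+* R)
    (μ : Partn) (hμ : μ.weight ≤ n) :
    JT n μ.parts (PowerSeries.map φ (HX n) * PowerSeries.map ψ (HX n)) =
      ∑ σ ∈ FP n, ∑ α ∈ FP n, lrCoeff σ α μ • (φ (SS n σ.parts) * ψ (SS n α.parts)) := by
  have h1 : ∀ β : Fin n → ℕ, ∑ i, β i = ∑ i : Fin n, μ.parts i →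
      hS (PowerSeries.map φ (HX n) * PowerSeries.map ψ (HX n)) β =
      ∑ σ ∈ FP n, ∑ α ∈ FP n, coef β (SS n σ.parts * SS n α.parts) •
        (φ (SS n σ.parts) * ψ (SS n α.parts)) := by
    intro β hβ
    rw [← weight_eq μ n (length_le μ n hμ)] at hβ
    rw [hS_mul]
    have h2 : ∀ p ∈ Finset.HasAntidiagonal.antidiagonal (Finsupp.equivFunOnFinite.symm β),
        hS (PowerSeries.map φ (HX n)) p.1 * hS (PowerSeries.map ψ (HX n)) p.2 =
        ∑ σ ∈ FP n, ∑ α ∈ FP n, (coef p.1 (SS n σ.parts) * coef p.2 (SS n α.parts)) •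
          (φ (SS n σ.parts) * ψ (SS n α.parts)) := by
      intro p hp
      rw [Finset.HasAntidiagonal.mem_antidiagonal] at hp
      have h3 : ∑ i, p.1 i + ∑ i, p.2 i = ∑ i, β i := by
        rw [← Finset.sum_add_distrib]
        refine Finset.sum_congr rfl fun i _ => ?_
        simpa using DFunLike.congr_fun hp i
      rw [← map_hS, ← map_hS, cauchy n p.1 (by omega), cauchy n p.2 (by omega), map_sum, map_sum,
        Finset.sum_mul_sum]
      refine Finset.sum_congr rfl fun σ _ => Finset.sum_congr rfl fun α _ => ?_
      rw [map_zsmul, map_zsmul, smul_mul_smul_comm]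
    rw [Finset.sum_congr rfl h2, Finset.sum_comm]
    refine Finset.sum_congr rfl fun σ _ => ?_
    rw [Finset.sum_comm]
    refine Finset.sum_congr rfl fun α _ => ?_
    rw [coef_mul, Finset.sum_smul]
  unfold JT
  rw [JJ_congr n _ _ _ h1, JJ_sum]
  refine Finset.sum_congr rfl fun σ hσ => ?_
  rw [JJ_sum]
  refine Finset.sum_congr rfl fun α hα => ?_
  rw [mem_FP] at hσ hα
  rw [JJ_smul, lrCoeff_eq n σ α μ hσ hα hμ]

open scoped TensorProduct in
theorem exists_tensor_functional {R A : Type*} [CommRing R] [CommRing A] [Algebra R A]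
    (f g : A →ₗ[R] R) : ∃ F : A ⊗[R] A →+ R, ∀ a b : A, F (a ⊗ₜ[R] b) = f a * g b :=
  ⟨((LinearMap.mul' R R) ∘ₗ TensorProduct.map f g).toAddMonoidHom, by intro a b; simp⟩

open scoped TensorProduct in
theorem main_finite (n : ℕ) (μ ν ρ l : Partn) (h : μ.weight + ν.weight ≤ n)
    (hρ : ρ.weight ≤ n) (hl : l.weight ≤ n) :
    ∑ κ ∈ FP n, lrCoeff μ ν κ * lrCoeff ρ l κ =
    ∑ σ ∈ FP n, ∑ τ ∈ FP n, ∑ α ∈ FP n, ∑ β ∈ FP n,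
      lrCoeff σ τ ρ * lrCoeff σ α μ * lrCoeff τ β ν * lrCoeff α β l := by
  let A := MvPolynomial (Fin n) ℤ
  let φ : A →+* A ⊗[ℤ] A := (Algebra.TensorProduct.includeLeft : A →ₐ[ℤ] A ⊗[ℤ] A).toRingHom
  let ψ : A →+* A ⊗[ℤ] A := (Algebra.TensorProduct.includeRight : A →ₐ[ℤ] A ⊗[ℤ] A).toRingHom
  have hφψ : ∀ a b : A, φ a * ψ b = a ⊗ₜ[ℤ] b := by
    intro a b
    simp [φ, ψ]
  let H := PowerSeries.map φ (HX n) * PowerSeries.map ψ (HX n)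
  let T : Partn → A ⊗[ℤ] A := fun κ => JT n κ.parts H
  -- the specialization from `2 n` variables
  let θ : MvPolynomial (Fin (n + n)) ℤ →+* A ⊗[ℤ] A :=
    (MvPolynomial.aeval (Fin.addCases (fun i => φ (X i)) (fun i => ψ (X i))) :
      MvPolynomial (Fin (n + n)) ℤ →ₐ[ℤ] A ⊗[ℤ] A).toRingHom
  have hθ : PowerSeries.map θ (HX (n + n)) = H := by
    have e1 : PowerSeries.map φ (HX n) = ∏ i, PowerSeries.mk (fun k => φ (X i) ^ k) := map_HX n φ
    have e2 : PowerSeries.map ψ (HX n) = ∏ i, PowerSeries.mk (fun k => ψ (X i) ^ k) := map_HX n ψ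
    have e3 : ∀ i, θ (X (Fin.castAdd n i)) = φ (X i) := by
      intro i
      simp only [θ, AlgHom.toRingHom_eq_coe, RingHom.coe_coe, aeval_X, Fin.addCases_left]
    have e4 : ∀ i, θ (X (Fin.natAdd n i)) = ψ (X i) := by
      intro i
      simp only [θ, AlgHom.toRingHom_eq_coe, RingHom.coe_coe, aeval_X, Fin.addCases_right]
    rw [map_HX, Fin.prod_univ_add]
    simp only [e3, e4, H, e1, e2]
  have hH0 : PowerSeries.coeff 0 H = 1 := by
    rw [← hθ, PowerSeries.coeff_map, coeff_zero_HX, map_one]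
  have hT : ∀ κ : Partn, κ.weight ≤ n → θ (SS (n + n) κ.parts) = T κ := by
    intro κ hκ
    unfold SS
    rw [map_JT, hθ, JT_stable n (n + n) (by omega) _ (length_le κ n hκ) _ hH0]
  have hprod : T μ * T ν = ∑ κ ∈ FP n, lrCoeff μ ν κ • T κ := by
    rw [← hT μ (by omega), ← hT ν (by omega), ← map_mul,
      prod_rule (n + n) n (by omega) μ ν h, map_sum]
    refine Finset.sum_congr rfl fun κ hκ => ?_
    rw [mem_FP] at hκ
    rw [map_zsmul, hT κ hκ]
  have hcop : ∀ κ : Partn, κ.weight ≤ n → T κ = ∑ σ ∈ FP n, ∑ α ∈ FP n,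
      lrCoeff σ α κ • (SS n σ.parts ⊗ₜ[ℤ] SS n α.parts) := by
    intro κ hκ
    have := coproduct n φ ψ κ hκ
    simp only [hφψ] at this
    exact this
  -- coefficient functionals
  let L : Partn → (A →ₗ[ℤ] ℤ) := fun κ =>
    (coef (fun j : Fin n => κ.parts j + (n - 1 - (j : ℕ)))) ∘ₗ
      (LinearMap.mulRight ℤ (vandermondeP n))
  have hL : ∀ (κ : Partn) (f : A), L κ f = JJ n κ.parts (fun β => coef β f) := by
    intro κ f
    rw [← coef_mul_vander]
    rfl
  obtain ⟨LL, hLL⟩ := exists_tensor_functional (L ρ) (L l)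
  have hLT : ∀ κ : Partn, κ.weight ≤ n → LL (T κ) = lrCoeff ρ l κ := by
    intro κ hκ
    rw [hcop κ hκ, map_sum]
    have h1 : ∀ σ ∈ FP n, LL (∑ α ∈ FP n, lrCoeff σ α κ • (SS n σ.parts ⊗ₜ[ℤ] SS n α.parts)) =
        if σ = ρ then lrCoeff ρ l κ else 0 := by
      intro σ hσ
      rw [mem_FP] at hσ
      rw [map_sum]
      have h2 : ∀ α ∈ FP n, LL (lrCoeff σ α κ • (SS n σ.parts ⊗ₜ[ℤ] SS n α.parts)) =
          if α = l then (if σ = ρ then lrCoeff ρ l κ else 0) else 0 := by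
        intro α hα
        rw [mem_FP] at hα
        rw [map_zsmul, hLL, hL, hL, JJ_SS n σ ρ hσ (length_le ρ n hρ),
          JJ_SS n α l hα (length_le l n hl)]
        split_ifs with h3 h4 <;> simp_all
      rw [Finset.sum_congr rfl h2, Finset.sum_ite_eq', if_pos ((mem_FP n l).2 hl)]
    rw [Finset.sum_congr rfl h1, Finset.sum_ite_eq', if_pos ((mem_FP n ρ).2 hρ)]
  have hleft : LL (T μ * T ν) = ∑ κ ∈ FP n, lrCoeff μ ν κ * lrCoeff ρ l κ := by
    rw [hprod, map_sum]
    refine Finset.sum_congr rfl fun κ hκ => ?_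
    rw [mem_FP] at hκ
    rw [map_zsmul, hLT κ hκ, smul_eq_mul]
  rw [← hleft, hcop μ (by omega), hcop ν (by omega), Finset.sum_mul_sum, map_sum]
  refine Finset.sum_congr rfl fun σ hσ => ?_
  rw [map_sum]
  refine Finset.sum_congr rfl fun τ hτ => ?_
  rw [Finset.sum_mul_sum, map_sum]
  refine Finset.sum_congr rfl fun α hα => ?_
  rw [map_sum]
  refine Finset.sum_congr rfl fun β hβ => ?_
  rw [mem_FP] at hσ hτ hα hβ
  rw [smul_mul_smul_comm, Algebra.TensorProduct.tmul_mul_tmul, map_zsmul, hLL, hL, hL,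
    ← lrCoeff_eq n σ τ ρ hσ hτ hρ, ← lrCoeff_eq n α β l hα hβ hl, smul_eq_mul]
  ring

theorem finsum_FP (n : ℕ) (f : Partn → ℤ) (h : ∀ p : Partn, n < p.weight → f p = 0) :
    ∑ᶠ p, f p = ∑ p ∈ FP n, f p := by
  apply finsum_eq_sum_of_support_subset
  intro p hp
  rw [Finset.mem_coe, mem_FP]
  by_contra hn
  exact hp (h p (by omega))

theorem lr_skew_product (μ ν ρ l : Partn) :
    (∑ᶠ κ : Partn, lrCoeff μ ν κ * lrCoeff ρ l κ) =
    ∑ᶠ (σ : Partn) (τ : Partn) (α : Partn) (β : Partn),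
      lrCoeff σ τ ρ * lrCoeff σ α μ * lrCoeff τ β ν * lrCoeff α β l := by
  obtain ⟨n, hn⟩ : ∃ n, n = μ.weight + ν.weight + ρ.weight + l.weight := ⟨_, rfl⟩
  have h4 : ∀ σ τ α : Partn, ∑ᶠ β : Partn,
      lrCoeff σ τ ρ * lrCoeff σ α μ * lrCoeff τ β ν * lrCoeff α β l = ∑ β ∈ FP n,
      lrCoeff σ τ ρ * lrCoeff σ α μ * lrCoeff τ β ν * lrCoeff α β l := by
    intro σ τ α
    apply finsum_FP
    intro β hβ
    rw [lrCoeff_zero α β l (by omega), mul_zero]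
  simp only [h4]
  have h3 : ∀ σ τ : Partn, ∑ᶠ α : Partn, ∑ β ∈ FP n,
      lrCoeff σ τ ρ * lrCoeff σ α μ * lrCoeff τ β ν * lrCoeff α β l =
      ∑ α ∈ FP n, ∑ β ∈ FP n,
      lrCoeff σ τ ρ * lrCoeff σ α μ * lrCoeff τ β ν * lrCoeff α β l := by
    intro σ τ
    apply finsum_FP
    intro α hα
    refine Finset.sum_eq_zero fun β _ => ?_
    rw [lrCoeff_zero α β l (by omega), mul_zero]
  simp only [h3]
  have h2 : ∀ σ : Partn, ∑ᶠ τ : Partn, ∑ α ∈ FP n, ∑ β ∈ FP n,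
      lrCoeff σ τ ρ * lrCoeff σ α μ * lrCoeff τ β ν * lrCoeff α β l =
      ∑ τ ∈ FP n, ∑ α ∈ FP n, ∑ β ∈ FP n,
      lrCoeff σ τ ρ * lrCoeff σ α μ * lrCoeff τ β ν * lrCoeff α β l := by
    intro σ
    apply finsum_FP
    intro τ hτ
    refine Finset.sum_eq_zero fun α _ => Finset.sum_eq_zero fun β _ => ?_
    rw [lrCoeff_zero σ τ ρ (by omega)]
    ring
  simp only [h2]
  rw [finsum_FP n, finsum_FP n]
  · exact main_finite n μ ν ρ l (by omega) (by omega) (by omega)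
  · intro σ hσ
    refine Finset.sum_eq_zero fun τ _ => Finset.sum_eq_zero fun α _ =>
      Finset.sum_eq_zero fun β _ => ?_
    rw [lrCoeff_zero σ τ ρ (by omega)]
    ring
  · intro κ hκ
    rw [lrCoeff_zero μ ν κ (by omega), zero_mul]
end

section
/- Let k be a positive integer and λ a partition with ℓ(λ) ≤ k. Then, in the field of fractions of ℚ[x_1,…,x_k]: sp_λ(x_1,…,x_k) = Σ_{α,μ} (−1)^{|α|/2} c^λ_{αμ} s_μ(x_1,…,x_k,x_1^{−1},…,x_k^{−1}), where α runs over partitions whose Frobenius symbol has the form (a_1,…,a_r | a_1+1,…,a_r+1) (leg lengths exceeding arm lengths by one), μ runs over partitions with ℓ(μ) ≤ 2k and |μ| = |λ| − |α|, and s_μ is the Schur polynomial in 2k variables evaluated at x_1,…,x_k,x_1^{−1},…,x_k^{−1}. This is the universal character identity ⟨λ⟩ = {λ/A} with A(x) = ∏_{i<j}(1 − x_i x_j), specialized to Sp(2k). -/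
open MvPolynomial
open scoped Classical

/-- The field of fractions of `ℚ[x_1,…,x_k]`. -/
abbrev RatFn (k : ℕ) := FractionRing (MvPolynomial (Fin k) ℚ)

/-- The image of the variable `x_i` in the field of fractions. -/
noncomputable def xv (k : ℕ) (i : Fin k) : RatFn k :=
  algebraMap (MvPolynomial (Fin k) ℚ) (RatFn k) (X i)

/-- The symplectic character `sp_λ(x_1,…,x_k)`:
`det(x_i^{λ_j+k−j+1} − x_i^{−(λ_j+k−j+1)}) / det(x_i^{k−j+1} − x_i^{−(k−j+1)})`
(1-based `j`; below `j` is 0-based so the exponents are `λ_j + (k − j)`). -/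
noncomputable def spChar (k : ℕ) (l : ℕ → ℕ) : RatFn k :=
  (Matrix.of fun i j : Fin k =>
      xv k i ^ ((l (j : ℕ) + (k - (j : ℕ)) : ℕ) : ℤ) -
        xv k i ^ (-((l (j : ℕ) + (k - (j : ℕ)) : ℕ) : ℤ))).det /
  (Matrix.of fun i j : Fin k =>
      xv k i ^ (((k - (j : ℕ) : ℕ)) : ℤ) -
        xv k i ^ (-((k - (j : ℕ) : ℕ) : ℤ))).det

/-- The odd orthogonal character `so_λ(z_1,…,z_k)`:
`det(z_i^{2(λ_j+k−j)+1} − z_i^{−(2(λ_j+k−j)+1)}) / det(z_i^{2(k−j)+1} − z_i^{−(2(k−j)+1)})`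
(1-based `j`; below `j` is 0-based so the exponents are `2(λ_j + (k−1−j)) + 1`). -/
noncomputable def soChar (k : ℕ) (l : ℕ → ℕ) : RatFn k :=
  (Matrix.of fun i j : Fin k =>
      xv k i ^ ((2 * (l (j : ℕ) + (k - 1 - (j : ℕ))) + 1 : ℕ) : ℤ) -
        xv k i ^ (-((2 * (l (j : ℕ) + (k - 1 - (j : ℕ))) + 1 : ℕ) : ℤ))).det /
  (Matrix.of fun i j : Fin k =>
      xv k i ^ ((2 * (k - 1 - (j : ℕ)) + 1 : ℕ) : ℤ) -
        xv k i ^ (-((2 * (k - 1 - (j : ℕ)) + 1 : ℕ) : ℤ))).det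

/-- The list of values `x_1,…,x_k,x_1^{−1},…,x_k^{−1}` at which Schur polynomials
in `2k` variables are evaluated for `Sp(2k)`. -/
noncomputable def spEval (k : ℕ) : Fin (2 * k) → RatFn k := fun i =>
  if h : (i : ℕ) < k then xv k ⟨i, h⟩
  else (xv k ⟨(i : ℕ) - k, by have := i.isLt; omega⟩)⁻¹

/-- The list of values `z_1²,…,z_k²,z_1^{−2},…,z_k^{−2},1` at which Schur polynomials
in `2k+1` variables are evaluated for `SO(2k+1)`. -/
noncomputable def soEval (k : ℕ) : Fin (2 * k + 1) → RatFn k := fun i =>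
  if h : (i : ℕ) < k then xv k ⟨i, h⟩ ^ 2
  else if h2 : (i : ℕ) < 2 * k then ((xv k ⟨(i : ℕ) - k, by omega⟩)⁻¹) ^ 2
  else 1



namespace SpU

section Generic
variable {S : Type*} [CommRing S]

/-- Homogenization of a univariate polynomial. -/
noncomputable def homg {A : Type*} [CommRing A] (φ : S →+* A) (a b : A) (P : Polynomial S) (d : ℕ) : A :=
  ∑ j ∈ Finset.range (d + 1), φ (P.coeff j) * (a ^ j * b ^ (d - j))

theorem homg_X_mul {A : Type*} [CommRing A] (φ : S →+* A) (a b : A) (P : Polynomial S) (d : ℕ) :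
    homg φ a b (Polynomial.X * P) (d + 1) = a * homg φ a b P d := by
  unfold homg
  rw [Finset.sum_range_succ']
  simp only [Polynomial.coeff_X_mul, Polynomial.mul_coeff_zero, Polynomial.coeff_X_zero, zero_mul,
    map_zero, add_zero, Finset.mul_sum]
  refine Finset.sum_congr rfl fun j _ => ?_
  rw [show d + 1 - (j + 1) = d - j by omega]
  ring

theorem homg_lift {A : Type*} [CommRing A] (φ : S →+* A) (a b : A) (P : Polynomial S) (d : ℕ)
    (h : P.natDegree ≤ d) :
    homg φ a b P (d + 1) = b * homg φ a b P d := by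
  unfold homg
  rw [Finset.sum_range_succ, Polynomial.coeff_eq_zero_of_natDegree_lt (by omega : P.natDegree < d + 1)]
  simp only [map_zero, zero_mul, add_zero, Finset.mul_sum]
  refine Finset.sum_congr rfl fun j hj => ?_
  rw [Finset.mem_range] at hj
  rw [show d + 1 - j = (d - j) + 1 by omega]
  ring

theorem homg_sub {A : Type*} [CommRing A] (φ : S →+* A) (a b : A) (P Q : Polynomial S) (d : ℕ) :
    homg φ a b (P - Q) d = homg φ a b P d - homg φ a b Q d := by
  unfold homg
  rw [← Finset.sum_sub_distrib]
  refine Finset.sum_congr rfl fun j _ => ?_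
  rw [Polynomial.coeff_sub, map_sub]; ring

theorem homg_C_mul {A : Type*} [CommRing A] (φ : S →+* A) (a b : A) (c : S) (P : Polynomial S) (d : ℕ) :
    homg φ a b (Polynomial.C c * P) d = φ c * homg φ a b P d := by
  unfold homg
  rw [Finset.mul_sum]
  refine Finset.sum_congr rfl fun j _ => ?_
  rw [Polynomial.coeff_C_mul, map_mul]; ring

theorem natDegree_prod_le {ι : Type*} (w : ι → S) (s : Finset ι) :
    (∏ i ∈ s, (Polynomial.X - Polynomial.C (w i))).natDegree ≤ s.card := by
  refine (Polynomial.natDegree_prod_le _ _).trans ?_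
  refine (Finset.sum_le_card_nsmul _ _ 1 fun i _ => ?_).trans (by simp)
  exact Polynomial.natDegree_X_sub_C_le _

theorem homg_prod {A : Type*} [CommRing A] (φ : S →+* A) (a b : A) {ι : Type*} (w : ι → S)
    (s : Finset ι) :
    homg φ a b (∏ i ∈ s, (Polynomial.X - Polynomial.C (w i))) s.card
      = ∏ i ∈ s, (a - φ (w i) * b) := by
  induction s using Finset.induction_on with
  | empty => simp [homg]
  | insert i s hi ih =>
    rw [Finset.prod_insert hi, Finset.prod_insert hi, Finset.card_insert_of_notMem hi, sub_mul,
      homg_sub, homg_C_mul, homg_X_mul, homg_lift _ _ _ _ _ (natDegree_prod_le w s), ih]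
    ring

theorem homg_X_pow_mul {A : Type*} [CommRing A] (φ : S →+* A) (a b : A) (P : Polynomial S) (d m : ℕ) :
    homg φ a b (Polynomial.X ^ m * P) (d + m) = a ^ m * homg φ a b P d := by
  induction m with
  | zero => simp
  | succ m ih =>
    rw [pow_succ', mul_assoc, ← add_assoc, homg_X_mul, ih]; ring

/-- The entries of the Jacobi–Trudi type matrix: the coefficient of `t^(l_i - i + j)` in
`(1 + ε t²)^j H(t)`. -/
noncomputable def jm (ε : S) (H : PowerSeries S) (l : ℕ → ℕ) (i j : ℕ) : S :=
  if i ≤ l i + j then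
    PowerSeries.coeff (l i + j - i) ((1 + PowerSeries.C ε * PowerSeries.X ^ 2) ^ j * H) else 0

noncomputable def jd (ε : S) (H : PowerSeries S) (l : ℕ → ℕ) (n : ℕ) : S :=
  (Matrix.of fun i j : Fin n => jm ε H l i j).det

theorem jm_eq (ε : S) (H : PowerSeries S) (l : ℕ → ℕ) (n i j : ℕ) (hi : i < n) (hj : j < n) :
    jm ε H l i j = PowerSeries.coeff (l i + (n - 1 - i))
      (PowerSeries.X ^ (n - 1 - j) * ((1 + PowerSeries.C ε * PowerSeries.X ^ 2) ^ j * H)) := by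
  rw [PowerSeries.coeff_X_pow_mul', jm]
  by_cases h : i ≤ l i + j
  · rw [if_pos h, if_pos (by omega)]
    congr 2; omega
  · rw [if_neg h, if_neg (by omega)]

theorem jd_succ (ε : S) (H : PowerSeries S) (hH : PowerSeries.constantCoeff H = 1)
    (l : ℕ → ℕ) (n : ℕ) (hl : l n = 0) : jd ε H l (n + 1) = jd ε H l n := by
  unfold jd
  rw [Matrix.det_succ_row _ (Fin.last n), Finset.sum_eq_single (Fin.last n)]
  · have : jm ε H l n n = 1 := by
      rw [jm, if_pos (by omega), hl]; simp [hH]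
    simp only [Matrix.of_apply, Fin.val_last, this, Fin.succAbove_last]
    rw [Even.neg_one_pow ⟨n, rfl⟩]
    simp only [one_mul]
    rfl
  · intro j _ hj
    have hj' : (j : ℕ) < n := Fin.val_lt_last hj
    have : jm ε H l n j = 0 := by rw [jm, if_neg (by omega)]
    simp [this]
  · simp

theorem jd_add (ε : S) (H : PowerSeries S) (hH : PowerSeries.constantCoeff H = 1)
    (l : ℕ → ℕ) (n : ℕ) (hl : ∀ i, n ≤ i → l i = 0) (m : ℕ) :
    jd ε H l (n + m) = jd ε H l n := by
  induction m with
  | zero => rfl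
  | succ m ih => rw [← add_assoc, jd_succ ε H hH l _ (hl _ (by omega)), ih]

theorem jd_stable (ε : S) (H : PowerSeries S) (hH : PowerSeries.constantCoeff H = 1)
    (l : ℕ → ℕ) (n m : ℕ) (hn : ∀ i, n ≤ i → l i = 0) (hm : ∀ i, m ≤ i → l i = 0) :
    jd ε H l n = jd ε H l m := by
  rw [← jd_add ε H hH l n hn m, add_comm, jd_add ε H hH l m hm n]

theorem jd_zero (ε : S) (H : PowerSeries S) (hH : PowerSeries.constantCoeff H = 1) (n : ℕ) :
    jd ε H (fun _ => 0) n = 1 := by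
  rw [jd_stable ε H hH _ n 0 (by simp) (by simp)]
  simp [jd]

/-- the auxiliary matrix -/
noncomputable def bm {n : ℕ} (w g : Fin n → S) : Matrix (Fin n) (Fin n) S :=
  Matrix.of fun j m =>
    (∏ i ∈ Finset.univ.erase m, (Polynomial.X - Polynomial.C (w i))).coeff j * g m

theorem km_eq {n : ℕ} (ε : S) (w g : Fin n → S) (H : PowerSeries S) (K : Fin n → PowerSeries S)
    (hH : H * ∏ i, (1 + PowerSeries.C ε * PowerSeries.X ^ 2 - PowerSeries.C (w i) * PowerSeries.X) = 1)
    (hK : ∀ i, K i * (1 + PowerSeries.C ε * PowerSeries.X ^ 2 - PowerSeries.C (w i) * PowerSeries.X)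
      = PowerSeries.C (g i)) (l : ℕ → ℕ) :
    (Matrix.of fun i m : Fin n => PowerSeries.coeff (l i + (n - 1 - i)) (K m))
      = (Matrix.of fun i j : Fin n => jm ε H l i j) * bm w g := by
  ext i m
  rw [Matrix.mul_apply]
  simp only [Matrix.of_apply, bm]
  have hn : n - 1 + 1 = n := by have := i.isLt; omega
  have hcard : (Finset.univ.erase m).card = n - 1 := by
    rw [Finset.card_erase_of_mem (Finset.mem_univ _)]; simp
  have h1 : K m = PowerSeries.C (g m) * (homg PowerSeries.C (1 + PowerSeries.C ε * PowerSeries.X ^ 2)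
      PowerSeries.X (∏ i ∈ Finset.univ.erase m, (Polynomial.X - Polynomial.C (w i))) (n - 1) * H) := by
    rw [← hcard, homg_prod, ← hK m]
    calc K m = K m * 1 := by ring
      _ = K m * (H * ∏ i, (1 + PowerSeries.C ε * PowerSeries.X ^ 2 - PowerSeries.C (w i) * PowerSeries.X)) := by rw [hH]
      _ = _ := by rw [← Finset.mul_prod_erase _ _ (Finset.mem_univ m)]; ring
  rw [h1, homg, hn, PowerSeries.coeff_C_mul, Finset.sum_mul, map_sum, Finset.mul_sum,
    Finset.sum_range]
  refine Finset.sum_congr rfl fun j _ => ?_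
  rw [jm_eq ε H l n i j i.isLt j.isLt, mul_assoc, PowerSeries.coeff_C_mul]
  rw [show (1 + PowerSeries.C ε * PowerSeries.X ^ 2) ^ (j:ℕ) * PowerSeries.X ^ (n - 1 - (j:ℕ)) * H
    = PowerSeries.X ^ (n - 1 - (j:ℕ)) * ((1 + PowerSeries.C ε * PowerSeries.X ^ 2) ^ (j:ℕ) * H) by ring]
  ring

theorem const_one {n : ℕ} (ε : S) (w : Fin n → S) (H : PowerSeries S)
    (hH : H * ∏ i, (1 + PowerSeries.C ε * PowerSeries.X ^ 2 - PowerSeries.C (w i) * PowerSeries.X) = 1) :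
    PowerSeries.constantCoeff H = 1 := by
  have := congrArg (PowerSeries.constantCoeff (R := S)) hH
  simpa [map_mul, map_prod] using this

theorem det_km {n : ℕ} (ε : S) (w g : Fin n → S) (H : PowerSeries S) (K : Fin n → PowerSeries S)
    (hH : H * ∏ i, (1 + PowerSeries.C ε * PowerSeries.X ^ 2 - PowerSeries.C (w i) * PowerSeries.X) = 1)
    (hK : ∀ i, K i * (1 + PowerSeries.C ε * PowerSeries.X ^ 2 - PowerSeries.C (w i) * PowerSeries.X)
      = PowerSeries.C (g i)) :
    (Matrix.of fun i m : Fin n => PowerSeries.coeff (n - 1 - i) (K m)).det = (bm w g).det := by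
  have h := congrArg Matrix.det (km_eq ε w g H K hH hK (fun _ => 0))
  rw [Matrix.det_mul] at h
  have h2 := jd_zero ε H (const_one ε w H hH) n
  unfold jd at h2
  rw [h2, one_mul] at h
  simpa using h

theorem jd_mul {n : ℕ} (ε : S) (w g : Fin n → S) (H : PowerSeries S) (K : Fin n → PowerSeries S)
    (hH : H * ∏ i, (1 + PowerSeries.C ε * PowerSeries.X ^ 2 - PowerSeries.C (w i) * PowerSeries.X) = 1)
    (hK : ∀ i, K i * (1 + PowerSeries.C ε * PowerSeries.X ^ 2 - PowerSeries.C (w i) * PowerSeries.X)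
      = PowerSeries.C (g i)) (l : ℕ → ℕ) :
    jd ε H l n * (Matrix.of fun i m : Fin n => PowerSeries.coeff (n - 1 - i) (K m)).det =
    (Matrix.of fun i m : Fin n => PowerSeries.coeff (l i + (n - 1 - i)) (K m)).det := by
  rw [det_km ε w g H K hH hK, km_eq ε w g H K hH hK, Matrix.det_mul, jd]

theorem bm_ne_zero [IsDomain S] {n : ℕ} (w g : Fin n → S) (hw : Function.Injective w)
    (hg : ∀ i, g i ≠ 0) : (bm w g).det ≠ 0 := by
  intro h0
  have h : Matrix.vandermonde w * bm w g =
      Matrix.diagonal fun m => (∏ i ∈ Finset.univ.erase m, (w m - w i)) * g m := by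
    ext i m
    rw [Matrix.mul_apply]
    have hcard : (Finset.univ.erase m).card = n - 1 := by
      rw [Finset.card_erase_of_mem (Finset.mem_univ _)]; simp
    have hn : n - 1 + 1 = n := by have := i.isLt; omega
    have h1 := homg_prod (RingHom.id S) (w i) 1 w (Finset.univ.erase m)
    rw [hcard, homg, hn] at h1
    simp only [one_pow, mul_one, RingHom.id_apply] at h1
    rw [Finset.sum_range] at h1
    have h2 : ∑ j, Matrix.vandermonde w i j * bm w g j m =
        (∏ x ∈ Finset.univ.erase m, (w i - w x)) * g m := by
      rw [← h1, Finset.sum_mul]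
      refine Finset.sum_congr rfl fun j _ => ?_
      simp only [Matrix.vandermonde_apply, bm, Matrix.of_apply]; ring
    rw [h2, Matrix.diagonal_apply]
    split_ifs with him
    · rw [him]
    · rw [Finset.prod_eq_zero (Finset.mem_erase.2 ⟨him, Finset.mem_univ i⟩) (sub_self _), zero_mul]
  have h2 := congrArg Matrix.det h
  rw [Matrix.det_mul, h0, mul_zero, Matrix.det_diagonal] at h2
  refine Finset.prod_ne_zero_iff.2 (fun m _ => ?_) h2.symm
  refine mul_ne_zero (Finset.prod_ne_zero_iff.2 fun i hi => ?_) (hg m)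
  exact sub_ne_zero.2 fun h => (Finset.mem_erase.1 hi).1 (hw h).symm

/-- Vanishing of the Jacobi–Trudi determinant for too long partitions. -/
theorem jd_vanish [IsDomain S] {q : ℕ} (w : Fin q → S) (H : PowerSeries S)
    (hH : H * ∏ i, (1 - PowerSeries.C (w i) * PowerSeries.X) = 1)
    (l : ℕ → ℕ) (n : ℕ) (hq : q ≤ n) (hl : ∀ i, i < n + 1 → l i ≠ 0) :
    jd 0 H l (n + 1) = 0 := by
  unfold jd
  set P : Polynomial S := Polynomial.X ^ (n - q) * ∏ i, (Polynomial.X - Polynomial.C (w i)) with hP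
  have hmonic : P.Monic := (Polynomial.monic_X_pow _).mul
    (Polynomial.monic_prod_of_monic _ _ fun i _ => Polynomial.monic_X_sub_C _)
  have hdeg : P.natDegree ≤ n := by
    refine (Polynomial.natDegree_mul_le).trans ?_
    have := natDegree_prod_le w Finset.univ
    simp only [Finset.card_univ, Fintype.card_fin] at this
    have h2 := Polynomial.natDegree_X_pow_le (R := S) (n - q)
    omega
  have hh : homg PowerSeries.C (1 : PowerSeries S) PowerSeries.X P n * H = 1 := by
    have h1 := homg_X_pow_mul PowerSeries.C (1 : PowerSeries S) PowerSeries.X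
      (∏ i, (Polynomial.X - Polynomial.C (w i))) q (n - q)
    have h2 := homg_prod PowerSeries.C (1 : PowerSeries S) PowerSeries.X w Finset.univ
    simp only [Finset.card_univ, Fintype.card_fin] at h2
    rw [show q + (n - q) = n by omega, h2, one_pow, one_mul] at h1
    rw [hP, h1, mul_comm, hH]
  rw [← Matrix.exists_mulVec_eq_zero_iff]
  refine ⟨fun j => P.coeff j, ?_, ?_⟩
  · intro h0
    apply hmonic.ne_zero
    ext j
    by_cases hj : j < n + 1
    · exact congrFun h0 ⟨j, hj⟩
    · rw [Polynomial.coeff_eq_zero_of_natDegree_lt (by omega)]; simp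
  · ext i
    have h3 := congrArg (PowerSeries.coeff (l i + (n - i))) hh
    rw [PowerSeries.coeff_one, if_neg (by have := hl i i.isLt; omega), homg, Finset.sum_mul, map_sum,
      Finset.sum_range] at h3
    rw [Matrix.mulVec, dotProduct, Pi.zero_apply]
    refine Eq.trans ?_ h3
    refine Finset.sum_congr rfl fun j _ => ?_
    rw [Matrix.of_apply, jm_eq 0 H l (n+1) i j i.isLt j.isLt, mul_assoc, PowerSeries.coeff_C_mul]
    simp only [map_zero, zero_mul, add_zero, one_pow, one_mul, Nat.add_sub_cancel]
    ring

end Generic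
end SpU


namespace SpU

theorem geom_ps {S : Type*} [CommRing S] (x : S) :
    PowerSeries.mk (fun e => x ^ e) * (1 + PowerSeries.C 0 * PowerSeries.X ^ 2 - PowerSeries.C x * PowerSeries.X)
      = PowerSeries.C (1 : S) := by
  have h : PowerSeries.mk (fun e => x ^ e) * (1 + PowerSeries.C 0 * PowerSeries.X ^ 2 - PowerSeries.C x * PowerSeries.X)
    = PowerSeries.mk (fun e => x ^ e) - PowerSeries.C x * (PowerSeries.mk (fun e => x ^ e) * PowerSeries.X) := by
    simp only [map_zero]; ring
  rw [h]
  ext n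
  rw [map_sub, PowerSeries.coeff_C_mul, PowerSeries.coeff_mk, PowerSeries.coeff_C]
  cases n with
  | zero => simp
  | succ n => rw [PowerSeries.coeff_succ_mul_X, PowerSeries.coeff_mk]; simp; ring

theorem schur_mul (n : ℕ) (l : ℕ → ℕ) : schur n l * vandermondeP n = alternant n l := by
  have hex : ∃ q : MvPolynomial (Fin n) ℤ, q * vandermondeP n = alternant n l := by
    set Q : PowerSeries (MvPolynomial (Fin n) ℤ) :=
      ∏ i : Fin n, (1 + PowerSeries.C 0 * PowerSeries.X ^ 2 - PowerSeries.C (X i) * PowerSeries.X) with hQ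
    have hc : PowerSeries.constantCoeff Q = ((1 : (MvPolynomial (Fin n) ℤ)ˣ) : MvPolynomial (Fin n) ℤ) := by
      rw [hQ]; simp [map_prod]
    have hH : Q.invOfUnit 1 * Q = 1 := by
      rw [mul_comm]; exact PowerSeries.mul_invOfUnit Q 1 hc
    have := jd_mul 0 (fun i : Fin n => (X i : MvPolynomial (Fin n) ℤ)) (fun _ => 1) (Q.invOfUnit 1)
      (fun i => PowerSeries.mk (fun e => (X i : MvPolynomial (Fin n) ℤ) ^ e)) hH
      (fun i => geom_ps _) l
    refine ⟨jd 0 (Q.invOfUnit 1) l n, ?_⟩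
    simp only [PowerSeries.coeff_mk] at this
    unfold vandermondeP alternant
    rw [← Matrix.det_transpose, ← Matrix.det_transpose (Matrix.of fun i j : Fin n =>
      (X i : MvPolynomial (Fin n) ℤ) ^ (l (j : ℕ) + (n - 1 - (j : ℕ))))]
    exact this
  unfold schur
  rw [dif_pos hex]
  exact hex.choose_spec

theorem schur_eval {F : Type*} [CommRing F] [IsDomain F] (n : ℕ) (z : Fin n → F) (hz : Function.Injective z)
    (H : PowerSeries F) (hH : H * ∏ i, (1 - PowerSeries.C (z i) * PowerSeries.X) = 1) (l : ℕ → ℕ) :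
    aeval z (schur n l) = jd 0 H l n := by
  have hH' : H * ∏ i, (1 + PowerSeries.C 0 * PowerSeries.X ^ 2 - PowerSeries.C (z i) * PowerSeries.X) = 1 := by
    simpa using hH
  have h1 := jd_mul 0 z (fun _ => 1) H (fun i => PowerSeries.mk (fun e => z i ^ e)) hH'
      (fun i => geom_ps _) l
  have h2 := det_km 0 z (fun _ => 1) H (fun i => PowerSeries.mk (fun e => z i ^ e)) hH'
      (fun i => geom_ps _)
  have h3 : (bm z fun _ => (1:F)).det ≠ 0 := bm_ne_zero z _ hz (by simp)
  rw [← h2] at h3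
  refine mul_right_cancel₀ h3 ?_
  rw [h1]
  have h4 := congrArg (aeval z) (schur_mul n l)
  rw [map_mul] at h4
  simp only [PowerSeries.coeff_mk]
  unfold vandermondeP alternant at h4
  rw [← Matrix.det_transpose, ← Matrix.det_transpose (Matrix.of fun i j : Fin n =>
      (X i : MvPolynomial (Fin n) ℤ) ^ (l (j : ℕ) + (n - 1 - (j : ℕ)))), AlgHom.map_det, AlgHom.map_det] at h4
  convert h4 using 3 <;> ext i j <;> simp

section DP
variable {S : Type*} [CommRing S] {N : ℕ}

/-- coefficient at an exponent vector -/
noncomputable def cf (P : MvPolynomial (Fin N) S) (f : Fin N → ℕ) : S :=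
  coeff (Finsupp.equivFunOnFinite.symm f) P

theorem cf_prod (q : Fin N → Polynomial S) (f : Fin N → ℕ) :
    cf (∏ i, Polynomial.aeval (X i : MvPolynomial (Fin N) S) (q i)) f = ∏ i, (q i).coeff (f i) := by
  have h1 : ∀ i, Polynomial.aeval (X i : MvPolynomial (Fin N) S) (q i) =
      ∑ m ∈ Finset.range ((q i).natDegree + 1), C ((q i).coeff m) * X i ^ m := by
    intro i
    rw [Polynomial.aeval_eq_sum_range]
    simp [MvPolynomial.smul_eq_C_mul]
  simp_rw [h1]
  rw [Finset.prod_univ_sum, cf, coeff_sum]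
  have h2 : ∀ p : Fin N → ℕ, ∏ i, (C ((q i).coeff (p i)) * X i ^ p i : MvPolynomial (Fin N) S) =
      monomial (Finsupp.equivFunOnFinite.symm p) (∏ i, (q i).coeff (p i)) := by
    intro p
    rw [Finset.prod_mul_distrib, ← map_prod, MvPolynomial.monomial_eq]
    congr 1
    rw [Finsupp.prod_fintype _ _ (by simp)]
    simp
  simp_rw [h2, coeff_monomial]
  simp only [EmbeddingLike.apply_eq_iff_eq]
  rw [Finset.sum_ite_eq']
  split_ifs with h
  · rfl
  · simp only [Fintype.mem_piFinset, not_forall, Finset.mem_range] at h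
    obtain ⟨i, hi⟩ := h
    rw [Finset.prod_eq_zero (Finset.mem_univ i)]
    exact Polynomial.coeff_eq_zero_of_natDegree_lt (by omega)

noncomputable def dp (p : Fin N → Polynomial S) : MvPolynomial (Fin N) S :=
  (Matrix.of fun i j => Polynomial.aeval (X i : MvPolynomial (Fin N) S) (p j)).det

theorem cf_dp (p : Fin N → Polynomial S) (f : Fin N → ℕ) :
    cf (dp p) f = (Matrix.of fun i j => (p j).coeff (f i)).det := by
  unfold dp
  rw [← Matrix.det_transpose, Matrix.det_apply, ← Matrix.det_transpose, Matrix.det_apply, cf, coeff_sum]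
  refine Finset.sum_congr rfl fun σ _ => ?_
  have := cf_prod (fun i => p (σ i)) f
  unfold cf at this
  simp only [Matrix.transpose_apply, Matrix.of_apply]
  rw [← this]
  rcases Int.units_eq_one_or (Equiv.Perm.sign σ) with h | h <;> simp [h]

theorem cf_dp_perm (p : Fin N → Polynomial S) (f : Fin N → ℕ) (σ : Equiv.Perm (Fin N)) :
    cf (dp p) (f ∘ σ) = (Equiv.Perm.sign σ : ℤ) * cf (dp p) f := by
  rw [cf_dp, cf_dp]
  exact Matrix.det_permute σ (Matrix.of fun i j => (p j).coeff (f i))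

theorem cf_dp_noninj (p : Fin N → Polynomial S) (f : Fin N → ℕ) (hf : ¬ Function.Injective f) :
    cf (dp p) f = 0 := by
  rw [cf_dp]
  simp only [Function.Injective, not_forall] at hf
  obtain ⟨a, b, hab, hne⟩ := hf
  exact Matrix.det_zero_of_row_eq hne (by ext j; simp [hab])

structure IsAlt (P : MvPolynomial (Fin N) S) : Prop where
  perm : ∀ f (σ : Equiv.Perm (Fin N)), cf P (f ∘ σ) = (Equiv.Perm.sign σ : ℤ) * cf P f
  noninj : ∀ f, ¬ Function.Injective f → cf P f = 0

theorem isAlt_dp (p : Fin N → Polynomial S) : IsAlt (dp p) :=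
  ⟨fun f σ => cf_dp_perm p f σ, fun f hf => cf_dp_noninj p f hf⟩

theorem cf_sub (P Q : MvPolynomial (Fin N) S) (f) : cf (P - Q) f = cf P f - cf Q f := by
  simp [cf]

theorem cf_C_mul (c : S) (P : MvPolynomial (Fin N) S) (f) : cf (C c * P) f = c * cf P f := by
  simp [cf, coeff_C_mul]

theorem cf_sum {ι : Type*} (s : Finset ι) (P : ι → MvPolynomial (Fin N) S) (f) :
    cf (∑ i ∈ s, P i) f = ∑ i ∈ s, cf (P i) f := by
  simp [cf, coeff_sum]

theorem IsAlt.sub {P Q : MvPolynomial (Fin N) S} (hP : IsAlt P) (hQ : IsAlt Q) : IsAlt (P - Q) :=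
  ⟨fun f σ => by rw [cf_sub, cf_sub, hP.perm, hQ.perm]; ring,
   fun f hf => by rw [cf_sub, hP.noninj f hf, hQ.noninj f hf, sub_zero]⟩

theorem IsAlt.lin {ι : Type*} (s : Finset ι) (c : ι → S) (P : ι → MvPolynomial (Fin N) S)
    (hP : ∀ i ∈ s, IsAlt (P i)) : IsAlt (∑ i ∈ s, C (c i) * P i) :=
  ⟨fun f σ => by
    simp only [cf_sum, cf_C_mul, Finset.mul_sum]
    refine Finset.sum_congr rfl fun i hi => ?_
    rw [(hP i hi).perm]; ring,
   fun f hf => by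
    simp only [cf_sum, cf_C_mul]
    refine Finset.sum_eq_zero fun i hi => ?_
    rw [(hP i hi).noninj f hf, mul_zero]⟩

theorem exists_sort (f : Fin N → ℕ) (hf : Function.Injective f) :
    ∃ σ : Equiv.Perm (Fin N), StrictAnti (f ∘ σ) := by
  refine ⟨Fin.revPerm.trans (Tuple.sort f), ?_⟩
  have h1 := Tuple.monotone_sort f
  have h2 : StrictMono (f ∘ Tuple.sort f) := h1.strictMono_of_injective
    (hf.comp (Tuple.sort f).injective)
  intro a b hab
  exact h2 (Fin.rev_lt_rev.2 hab)

theorem IsAlt.eq_zero {P : MvPolynomial (Fin N) S} (hP : IsAlt P) (d : ℕ)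
    (h : ∀ e : Fin N → ℕ, StrictAnti e → ∑ i, e i ≤ d → cf P e = 0) (f : Fin N → ℕ)
    (hd : ∑ i, f i ≤ d) : cf P f = 0 := by
  by_cases hf : Function.Injective f
  · obtain ⟨σ, hσ⟩ := exists_sort f hf
    have h1 := h _ hσ (by simpa [Equiv.sum_comp σ f] using hd)
    rw [hP.perm] at h1
    rcases Int.units_eq_one_or (Equiv.Perm.sign σ) with hs | hs <;> simpa [hs] using h1
  · exact hP.noninj f hf

theorem ext_cf {P Q : MvPolynomial (Fin N) S} (h : ∀ f, cf P f = cf Q f) : P = Q := by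
  ext m
  have := h (Finsupp.equivFunOnFinite m)
  simpa [cf] using this

theorem det_delta (e f : Fin N → ℕ) (he : StrictAnti e) (hf : StrictAnti f) :
    (Matrix.of fun i j => if e i = f j then (1 : S) else 0).det = if e = f then 1 else 0 := by
  split_ifs with h
  · subst h
    convert Matrix.det_one (n := Fin N) (R := S) using 2
    ext i j
    simp [Matrix.one_apply, he.injective.eq_iff]
  · by_contra hne
    rw [← Matrix.det_transpose, Matrix.det_apply] at hne
    obtain ⟨σ, -, hσ⟩ := Finset.exists_ne_zero_of_sum_ne_zero hne
    have h2 : ∀ i, e i = f (σ i) := by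
      intro i
      by_contra hi
      apply hσ
      rw [Finset.prod_eq_zero (Finset.mem_univ i) (by simp [hi]), smul_zero]
    have hmono : StrictMono σ := by
      intro a b hab
      have := he hab
      rw [h2, h2] at this
      exact hf.lt_iff_gt.1 this
    have : (σ : Fin N → Fin N) = id := by
      refine (StrictMono.range_inj hmono strictMono_id).1 ?_
      simp [σ.surjective.range_eq]
    apply h
    funext i
    rw [h2, this]; rfl

end DP

end SpU


namespace SpU

theorem partn_ext {p q : Partn} (h : ∀ i, p.parts i = q.parts i) : p = q := by
  cases p; cases q
  congr
  funext i; exact h i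

theorem weight_eq (p : Partn) (n : ℕ) (h : p.LengthLE n) : p.weight = ∑ i ∈ Finset.range n, p.parts i := by
  unfold Partn.weight
  apply finsum_eq_sum_of_support_subset
  intro i hi
  simp only [Finset.coe_range, Set.mem_Iio]
  by_contra hn
  exact hi (h i (by omega))

theorem sum_le_weight (p : Partn) (n : ℕ) : ∑ i ∈ Finset.range n, p.parts i ≤ p.weight := by
  obtain ⟨M, hM⟩ := p.eventually_zero
  rw [weight_eq p (n + M) (fun i hi => hM i (by omega))]
  exact Finset.sum_le_sum_of_subset (Finset.range_mono (by omega))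

theorem lengthLE_weight (p : Partn) : p.LengthLE p.weight := by
  intro i hi
  by_contra h
  have h1 := sum_le_weight p (i + 1)
  have h2 : ∑ j ∈ Finset.range (i + 1), 1 ≤ ∑ j ∈ Finset.range (i + 1), p.parts j := by
    apply Finset.sum_le_sum
    intro j hj
    have := p.antitone j i (by simp at hj; omega)
    omega
  simp at h2
  omega

theorem lengthLE_of_weight (p : Partn) (n : ℕ) (h : p.weight ≤ n) : p.LengthLE n :=
  fun i hi => lengthLE_weight p i (h.trans hi)

theorem parts_le_weight (p : Partn) (i : ℕ) : p.parts i ≤ p.weight := by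
  refine le_trans ?_ (sum_le_weight p (i + 1))
  exact Finset.single_le_sum (f := p.parts) (fun _ _ => Nat.zero_le _) (by simp)

theorem finite_weight (M : ℕ) : {p : Partn | p.weight ≤ M}.Finite := by
  apply Set.Finite.of_finite_image (f := fun p : Partn => fun i : Fin M => (Fin.ofNat (M + 1) (p.parts i)))
  · exact Set.toFinite _
  · intro p hp q hq hpq
    apply partn_ext
    intro i
    simp only [Set.mem_ofPred_eq] at hp hq
    by_cases hi : i < M
    · have h1 := congrArg Fin.val (congrFun hpq ⟨i, hi⟩)
      have h2 := parts_le_weight p i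
      have h3 := parts_le_weight q i
      simp only [Fin.val_ofNat] at h1
      rwa [Nat.mod_eq_of_lt (by omega), Nat.mod_eq_of_lt (by omega)] at h1
    · rw [lengthLE_of_weight p M hp i (by omega), lengthLE_of_weight q M hq i (by omega)]

/-- exponent vector `p + ρ` -/
def ev (N : ℕ) (p : Partn) : Fin N → ℕ := fun i => p.parts i + (N - 1 - i)

theorem ev_strictAnti (N : ℕ) (p : Partn) : StrictAnti (ev N p) := by
  intro a b hab
  have h1 := p.antitone a b (le_of_lt hab)
  have := b.isLt
  have h2 : (a : ℕ) < b := hab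
  simp only [ev]; omega

theorem ev_inj (N : ℕ) (p q : Partn) (hp : p.LengthLE N) (hq : q.LengthLE N) (h : ev N p = ev N q) :
    p = q := by
  apply partn_ext
  intro i
  by_cases hi : i < N
  · have := congrFun h ⟨i, hi⟩
    simpa [ev] using this
  · rw [hp i (by omega), hq i (by omega)]

theorem exists_partn (N : ℕ) (e : Fin N → ℕ) (he : StrictAnti e) :
    ∃ p : Partn, p.LengthLE N ∧ ev N p = e := by
  have key : ∀ (d : ℕ) (i : Fin N), (i : ℕ) + d + 1 = N → d ≤ e i := by
    intro d
    induction d with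
    | zero => intro i _; exact Nat.zero_le _
    | succ d ih =>
      intro i hi
      have h1 := ih ⟨i + 1, by omega⟩ (by simp; omega)
      have h2 : e ⟨i + 1, by omega⟩ < e i := he (by rw [Fin.lt_def]; simp)
      omega
  have key2 : ∀ (d : ℕ) (i j : Fin N), (i : ℕ) + d = j → e j + d ≤ e i := by
    intro d
    induction d with
    | zero => intro i j h; have : i = j := by ext; omega
              rw [this]; simp
    | succ d ih =>
      intro i j h
      have := j.isLt
      have h1 := ih ⟨i + 1, by omega⟩ j (by simp; omega)
      have h2 : e ⟨i + 1, by omega⟩ < e i := he (by rw [Fin.lt_def]; simp)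
      omega
  refine ⟨⟨fun i => if h : i < N then e ⟨i, h⟩ - (N - 1 - i) else 0, ?_, ⟨N, fun i hi => ?_⟩⟩, ?_, ?_⟩
  · intro i j hij
    by_cases hj : j < N
    · rw [dif_pos hj, dif_pos (by omega)]
      have := key2 (j - i) ⟨i, by omega⟩ ⟨j, hj⟩ (by simp; omega)
      omega
    · rw [dif_neg hj]; exact Nat.zero_le _
  · rw [dif_neg (by omega)]
  · intro i hi
    simp only []
    rw [dif_neg (by omega)]
  · funext i
    have := key (N - 1 - i) i (by have := i.isLt; omega)
    simp only [ev, dif_pos i.isLt, Fin.eta]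
    omega

theorem sum_ev (N : ℕ) (p : Partn) (hp : p.LengthLE N) :
    ∑ i, ev N p i = p.weight + ∑ i : Fin N, (N - 1 - i) := by
  rw [weight_eq p N hp, Finset.sum_range, ← Finset.sum_add_distrib]; rfl

theorem conj_eq_iff (p : Partn) (i m : ℕ) :
    p.conjParts i = m ↔ (∀ j, j < m → i < p.parts j) ∧ p.parts m ≤ i := by
  have hex : ∃ j, p.parts j ≤ i := by
    obtain ⟨M, hM⟩ := p.eventually_zero
    exact ⟨M, by rw [hM M le_rfl]; omega⟩
  have h1 : p.conjParts i = Nat.find hex := by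
    unfold Partn.conjParts
    have : ∀ j, i < p.parts j ↔ j < Nat.find hex := by
      intro j
      constructor
      · intro h
        by_contra hn
        have := p.antitone (Nat.find hex) j (by omega)
        have := Nat.find_spec hex
        omega
      · intro h
        have := Nat.find_min hex h
        omega
    simp_rw [this]
    rw [Nat.card_congr (⟨fun j => ⟨j.1, j.2⟩, fun j => ⟨j.1, j.2⟩, fun _ => rfl, fun _ => rfl⟩ :
      {j : ℕ // j < Nat.find hex} ≃ Fin (Nat.find hex)), Nat.card_eq_fintype_card, Fintype.card_fin]
  rw [h1, Nat.find_eq_iff]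
  constructor
  · rintro ⟨a, b⟩; exact ⟨fun j hj => by have := b j hj; omega, a⟩
  · rintro ⟨a, b⟩; exact ⟨b, fun j hj => by have := a j hj; omega⟩

/-- the class of partitions `(a | a+1)` -/
def cls (α : Partn) : Prop := ∀ i, i < α.parts i → α.conjParts i = α.parts i + 1

def dd (α : Partn) (i : ℕ) : ℤ := (α.parts i : ℤ) - i

theorem dd_anti (α : Partn) {i j : ℕ} (h : i < j) : dd α j < dd α i := by
  have := α.antitone i j h.le
  simp only [dd]; omega

theorem cls_iff (α : Partn) : cls α ↔ ∀ i, i < α.parts i →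
    (∀ j, j < α.parts i + 1 → i < α.parts j) ∧ α.parts (α.parts i + 1) ≤ i := by
  unfold cls
  simp only [conj_eq_iff]

theorem cls_lt {N : ℕ} (α : Partn) (h : cls α) (hN : α.LengthLE N) (i : Fin N) : (dd α i).natAbs < N := by
  have hi := i.isLt
  by_cases hp : (i : ℕ) < α.parts i
  · have h1 := ((cls_iff α).1 h i hp).1 (α.parts i) (by omega)
    have h2 : α.parts i < N := by
      by_contra hn
      have := hN (α.parts i) (by omega)
      omega
    simp only [dd]; omega
  · simp only [dd]; omega

theorem cls_inj (α : Partn) (h : cls α) (i j : ℕ) (hij : (dd α i).natAbs = (dd α j).natAbs) : i = j := by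
  wlog hlt : i < j generalizing i j
  · rcases Nat.lt_trichotomy i j with h1 | h1 | h1
    · exact this i j hij h1
    · exact h1
    · exact (this j i hij.symm h1).symm
  exfalso
  have h1 := dd_anti α hlt
  have hneg : dd α j = - dd α i := by omega
  have hpos : i < α.parts i := by simp only [dd] at *; omega
  obtain ⟨h2, h3⟩ := (cls_iff α).1 h i hpos
  have h4 := h2 (α.parts i) (by omega)
  by_cases hj : j ≤ α.parts i
  · have := α.antitone j (α.parts i) hj
    simp only [dd] at *; omega
  · have := α.antitone (α.parts i + 1) j (by omega)
    simp only [dd] at *; omega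

theorem card_lt_perm {N : ℕ} (σ : Equiv.Perm (Fin N)) (i : Fin N) :
    (Finset.univ.filter fun j => σ j < σ i).card = (σ i : ℕ) := by
  have : (Finset.univ.filter fun j => σ j < σ i) = (Finset.Iio (σ i)).map σ.symm.toEmbedding := by
    ext j
    simp [Finset.mem_map_equiv]
  rw [this, Finset.card_map, Fin.card_Iio]

theorem perm_cls {N : ℕ} (α : Partn) (hN : α.LengthLE N) (σ : Equiv.Perm (Fin N))
    (hσ : ∀ i : Fin N, (dd α i).natAbs = σ i) : cls α := by
  rw [cls_iff]
  intro i hi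
  have hiN : i < N := by
    by_contra hn
    have := hN i (by omega)
    omega
  have hcard := card_lt_perm σ ⟨i, hiN⟩
  have hsi := hσ ⟨i, hiN⟩
  simp only at hsi
  have hdi : (dd α i).natAbs = α.parts i - i := by simp only [dd]; omega
  have hmem : ∀ j : Fin N, σ j < σ ⟨i, hiN⟩ ↔ (dd α j).natAbs < α.parts i - i := by
    intro j
    rw [Fin.lt_def, ← hσ, ← hsi, hdi]
  simp only [hmem] at hcard
  rw [← hsi, hdi] at hcard
  constructor
  · have hc : i < α.parts (α.parts i) := by
      by_contra hcon
      have hsub : (Finset.univ.filter fun j : Fin N => (dd α j).natAbs < α.parts i - i).map Fin.valEmbedding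
          ⊆ Finset.Ioo i (α.parts i) := by
        intro j hj
        simp only [Finset.mem_map, Finset.mem_filter, Finset.mem_univ, true_and, Fin.valEmbedding_apply] at hj
        obtain ⟨j', hj', rfl⟩ := hj
        rw [Finset.mem_Ioo]
        constructor
        · by_contra hle
          have := α.antitone j' i (by omega)
          simp only [dd] at hj'; omega
        · by_contra hle
          have := α.antitone (α.parts i) j' (by omega)
          simp only [dd] at hj'; omega
      have := Finset.card_le_card hsub
      rw [Finset.card_map, hcard, Nat.card_Ioo] at this
      omega
    intro j hj
    have := α.antitone j (α.parts i) (by omega)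
    omega
  · by_contra hcon
    have hcN : α.parts i + 1 < N := by
      by_contra hn
      have := hN (α.parts i + 1) (by omega)
      omega
    have hsub : Finset.Ioc i (α.parts i + 1) ⊆
        (Finset.univ.filter fun j : Fin N => (dd α j).natAbs < α.parts i - i).map Fin.valEmbedding := by
      intro j hj
      rw [Finset.mem_Ioc] at hj
      simp only [Finset.mem_map, Finset.mem_filter, Finset.mem_univ, true_and, Fin.valEmbedding_apply]
      refine ⟨⟨j, by omega⟩, ?_, rfl⟩
      have h1 := α.antitone j (α.parts i + 1) hj.2
      have h2 := α.antitone i j (by omega)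
      have h3 : (dd α j).natAbs ≠ (dd α i).natAbs := by
        intro heq
        have e1 := hσ ⟨j, by omega⟩
        simp only at e1
        rw [heq, hsi] at e1
        have := σ.injective (Fin.ext e1)
        simp only [Fin.mk.injEq] at this
        omega
      simp only [dd] at *; omega
    have := Finset.card_le_card hsub
    rw [Finset.card_map, hcard, Nat.card_Ioc] at this
    omega

theorem sign_eq {N : ℕ} (α : Partn) (hN : α.LengthLE N) (σ : Equiv.Perm (Fin N))
    (hσ : ∀ i : Fin N, (dd α i).natAbs = σ i) :
    ((Equiv.Perm.sign σ : ℤˣ) : ℤ) = (-1) ^ (α.weight / 2) := by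
  have hw : α.weight = 2 * ∑ i : Fin N, (dd α i).toNat := by
    have h1 : (α.weight : ℤ) = ∑ i : Fin N, (dd α i + (i : ℕ)) := by
      rw [weight_eq α N hN, Finset.sum_range]
      push_cast
      refine Finset.sum_congr rfl fun i _ => ?_
      simp [dd]
    have h2 : ∑ i : Fin N, ((i : ℕ) : ℤ) = ∑ i : Fin N, (((dd α i).natAbs : ℕ) : ℤ) := by
      simp_rw [hσ]
      exact (Equiv.sum_comp σ (fun i : Fin N => ((i : ℕ) : ℤ))).symm
    rw [Finset.sum_add_distrib, h2, ← Finset.sum_add_distrib] at h1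
    zify
    rw [h1, Finset.mul_sum]
    refine Finset.sum_congr rfl fun i _ => ?_
    omega
  rw [hw, Nat.mul_div_cancel_left _ (by norm_num), Equiv.Perm.sign_eq_prod_prod_Ioi, ← Finset.prod_pow_eq_pow_sum,
    Units.coe_prod]
  refine Finset.prod_congr rfl fun i _ => ?_
  rw [Units.coe_prod]
  by_cases hp : 0 < dd α i
  · have h1 : (dd α i).toNat = (Finset.univ.filter fun j => σ j < σ i).card := by
      rw [card_lt_perm, ← hσ]; omega
    have h2 : (Finset.univ.filter fun j => σ j < σ i) = (Finset.Ioi i).filter fun j => ¬ σ i < σ j := by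
      ext j
      simp only [Finset.mem_filter, Finset.mem_univ, true_and, Finset.mem_Ioi, not_lt]
      constructor
      · intro hj
        refine ⟨?_, hj.le⟩
        by_contra hle
        rcases lt_or_eq_of_le (not_lt.1 hle) with h | h
        · have := dd_anti α (show (j : ℕ) < i from h)
          have e1 := hσ i
          have e2 := hσ j
          rw [Fin.lt_def] at hj
          omega
        · rw [h] at hj; exact lt_irrefl _ hj
      · rintro ⟨a, b⟩
        rcases lt_or_eq_of_le b with h | h
        · exact h
        · exact absurd (σ.injective h) (ne_of_gt a)
    rw [h1, h2, ← Finset.prod_const, Finset.prod_filter]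
    refine Finset.prod_congr rfl fun j _ => ?_
    split_ifs <;> simp_all
  · rw [Int.toNat_of_nonpos (by omega), pow_zero]
    refine Finset.prod_eq_one fun j hj => ?_
    rw [if_pos]
    · rfl
    · rw [Finset.mem_Ioi, Fin.lt_def] at hj
      have := dd_anti α hj
      have e1 := hσ i
      have e2 := hσ j
      rw [Fin.lt_def]
      omega

theorem det_abs {N : ℕ} (α : Partn) (hN : α.LengthLE N) :
    (Matrix.of fun i j : Fin N => if (dd α i).natAbs = j then (1 : ℤ) else 0).det =
      if cls α then (-1) ^ (α.weight / 2) else 0 := by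
  split_ifs with h
  · set f : Fin N → Fin N := fun i => ⟨(dd α i).natAbs, cls_lt α h hN i⟩ with hf
    have hinj : Function.Injective f := by
      intro i j hij
      exact Fin.ext (cls_inj α h i j (congrArg Fin.val hij))
    set σ : Equiv.Perm (Fin N) := Equiv.ofBijective f (Finite.injective_iff_bijective.1 hinj) with hσ
    have hs : ∀ i : Fin N, (dd α i).natAbs = σ i := fun i => rfl
    rw [← sign_eq α hN σ hs]
    have h3 := Matrix.det_permutation (R := ℤ) σ
    rw [Int.cast_id] at h3
    rw [← h3]
    congr 1
    ext i j
    simp only [Matrix.of_apply, hs, Equiv.toPEquiv_apply, PEquiv.toMatrix_apply, Option.mem_def,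
      Option.some.injEq, Fin.ext_iff]
  · by_contra hne
    rw [← Matrix.det_transpose, Matrix.det_apply] at hne
    obtain ⟨σ, -, hσ⟩ := Finset.exists_ne_zero_of_sum_ne_zero hne
    apply h
    apply perm_cls α hN σ
    intro i
    by_contra hi
    apply hσ
    rw [Finset.prod_eq_zero (Finset.mem_univ i) (by simp [hi]), smul_zero]

end SpU


namespace SpU

section
variable {S : Type*} [CommRing S]

noncomputable def AA (S : Type*) [CommRing S] (N : ℕ) : MvPolynomial (Fin N) S :=
  ∏ i : Fin N, ∏ j ∈ Finset.Ioi i, (1 - X i * X j)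

theorem AA_mul (N : ℕ) :
    AA S N * dp (fun j : Fin N => (Polynomial.X : Polynomial S) ^ (N - 1 - (j : ℕ))) =
      dp (fun j : Fin N => Polynomial.X ^ (N - 1 - (j : ℕ)) * (1 + Polynomial.X ^ 2) ^ (j : ℕ)) := by
  have h1 : dp (fun j : Fin N => (Polynomial.X : Polynomial S) ^ (N - 1 - (j : ℕ))) =
      (Matrix.projVandermonde (fun _ => 1) (fun i : Fin N => (X i : MvPolynomial (Fin N) S))).det := by
    unfold dp
    congr 1
    ext1 i j
    rw [Matrix.projVandermonde_apply, Matrix.of_apply, Fin.val_rev]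
    simp only [map_pow, Polynomial.aeval_X, one_pow, one_mul]
    congr 1; omega
  have h2 : dp (fun j : Fin N => (Polynomial.X : Polynomial S) ^ (N - 1 - (j : ℕ)) * (1 + Polynomial.X ^ 2) ^ (j : ℕ)) =
      (Matrix.projVandermonde (fun i => 1 + X i ^ 2) (fun i : Fin N => (X i : MvPolynomial (Fin N) S))).det := by
    unfold dp
    congr 1
    ext1 i j
    rw [Matrix.projVandermonde_apply, Matrix.of_apply, Fin.val_rev]
    simp only [map_pow, Polynomial.aeval_X, map_mul, map_add, map_one]
    rw [mul_comm]
    congr 2; omega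
  rw [h1, h2, Matrix.det_projVandermonde, Matrix.det_projVandermonde, AA, ← Finset.prod_mul_distrib]
  refine Finset.prod_congr rfl fun i _ => ?_
  rw [← Finset.prod_mul_distrib]
  refine Finset.prod_congr rfl fun j _ => ?_
  ring

theorem alternant_eq (N : ℕ) (l : ℕ → ℕ) :
    alternant N l = dp (fun j : Fin N => (Polynomial.X : Polynomial ℤ) ^ (l j + (N - 1 - (j : ℕ)))) := by
  unfold alternant dp
  simp

theorem vandermondeP_eq (N : ℕ) :
    vandermondeP N = dp (fun j : Fin N => (Polynomial.X : Polynomial ℤ) ^ (N - 1 - (j : ℕ))) := by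
  unfold vandermondeP dp
  simp

noncomputable def chb (S : Type*) [CommRing S] : ℕ → Polynomial S
  | 0 => 1
  | 1 => Polynomial.X
  | 2 => Polynomial.X ^ 2 - 2
  | (n + 3) => Polynomial.X * chb S (n + 2) - chb S (n + 1)

theorem chb_spec [Nontrivial S] : ∀ n, (chb S n).Monic ∧ (chb S n).natDegree = n
  | 0 => by simp [chb]
  | 1 => by simp [chb, Polynomial.monic_X]
  | 2 => by
    have h : (Polynomial.X ^ 2 - 2 : Polynomial S) = Polynomial.X ^ 2 - Polynomial.C 2 := by
      rw [show (Polynomial.C 2 : Polynomial S) = 2 from map_ofNat _ 2]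
    rw [chb, h]
    exact ⟨Polynomial.monic_X_pow_sub_C _ (by norm_num), Polynomial.natDegree_X_pow_sub_C⟩
  | (n + 3) => by
    obtain ⟨h1, h2⟩ := chb_spec (n + 2)
    obtain ⟨h3, h4⟩ := chb_spec (n + 1)
    have hm : (Polynomial.X * chb S (n + 2)).Monic := Polynomial.monic_X.mul h1
    have hd : (Polynomial.X * chb S (n + 2)).natDegree = n + 3 := by
      rw [Polynomial.natDegree_X_mul h1.ne_zero, h2]
    have hlt : (chb S (n + 1)).degree < (Polynomial.X * chb S (n + 2)).degree := by
      apply Polynomial.degree_lt_degree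
      omega
    rw [chb]
    refine ⟨hm.sub_of_left hlt, ?_⟩
    rw [Polynomial.natDegree_sub_eq_left_of_natDegree_lt (by omega), hd]

theorem chb_eval {K : Type*} [Field K] (y : K) (hy : y ≠ 0) :
    ∀ n, (chb K n).eval (y + y⁻¹) = if n = 0 then 1 else y ^ n + y⁻¹ ^ n
  | 0 => by simp [chb]
  | 1 => by simp [chb]
  | 2 => by
    simp [chb]; field_simp; ring
  | (n + 3) => by
    rw [chb, Polynomial.eval_sub, Polynomial.eval_mul, Polynomial.eval_X, chb_eval y hy (n + 2),
      chb_eval y hy (n + 1)]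
    simp only [Nat.add_eq_zero_iff, OfNat.ofNat_ne_zero, one_ne_zero, and_false, if_false, inv_pow]
    field_simp
    ring

theorem aux1 {K : Type*} [Field K] (y : K) (hy : y ≠ 0) : 1 + y ^ 2 = y * (y + y⁻¹) := by
  field_simp; ring

theorem aux2 {K : Type*} [Field K] (y : K) (hy : y ≠ 0) (a : K) (j : ℕ) :
    a + a * y ^ j * y ^ j = a * y ^ j * (y ^ j + y⁻¹ ^ j) := by
  rw [inv_pow]; field_simp; ring

noncomputable def cpol (N : ℕ) (j : ℕ) : Polynomial ℤ :=
  if j = 0 then Polynomial.X ^ (N - 1) else Polynomial.X ^ (N - 1 - j) + Polynomial.X ^ (N - 1 + j)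

theorem dp_cheb (N : ℕ) :
    dp (fun j : Fin N => (Polynomial.X : Polynomial ℤ) ^ (N - 1 - (j : ℕ)) * (1 + Polynomial.X ^ 2) ^ (j : ℕ))
      = dp (fun j : Fin N => cpol N j) := by
  set K := FractionRing (MvPolynomial (Fin N) ℤ)
  have hinj : Function.Injective (algebraMap (MvPolynomial (Fin N) ℤ) K) := IsFractionRing.injective _ _
  apply hinj
  set y : Fin N → K := fun i => algebraMap (MvPolynomial (Fin N) ℤ) K (X i) with hy
  have hy0 : ∀ i, y i ≠ 0 := by
    intro i h
    rw [hy] at h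
    simp only at h
    rw [map_eq_zero_iff _ hinj] at h
    exact X_ne_zero i h
  unfold dp
  rw [RingHom.map_det, RingHom.map_det]
  have h1 : (algebraMap (MvPolynomial (Fin N) ℤ) K).mapMatrix (Matrix.of fun i j : Fin N =>
      Polynomial.aeval (X i : MvPolynomial (Fin N) ℤ)
        ((Polynomial.X : Polynomial ℤ) ^ (N - 1 - (j : ℕ)) * (1 + Polynomial.X ^ 2) ^ (j : ℕ)))
      = Matrix.of fun i j : Fin N => y i ^ (N - 1) * Matrix.vandermonde (fun i => y i + (y i)⁻¹) i j := by
    ext i j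
    simp only [RingHom.mapMatrix_apply, Matrix.map_apply, Matrix.of_apply, map_mul, map_pow,
      Polynomial.aeval_X, map_add, map_one, Matrix.vandermonde_apply]
    change y i ^ (N - 1 - (j : ℕ)) * (1 + y i ^ 2) ^ (j : ℕ) = _
    have e : 1 + y i ^ 2 = y i * (y i + (y i)⁻¹) := aux1 (y i) (hy0 i)
    have hj := j.isLt
    rw [e, mul_pow, ← mul_assoc, ← pow_add]
    congr 2; omega
  have h2 : (algebraMap (MvPolynomial (Fin N) ℤ) K).mapMatrix (Matrix.of fun i j : Fin N =>
      Polynomial.aeval (X i : MvPolynomial (Fin N) ℤ) (cpol N j))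
      = Matrix.of fun i j : Fin N => y i ^ (N - 1) *
        (Matrix.of fun i j : Fin N => (chb K j).eval (y i + (y i)⁻¹)) i j := by
    ext i j
    have hj := j.isLt
    simp only [RingHom.mapMatrix_apply, Matrix.map_apply, Matrix.of_apply]
    rw [chb_eval _ (hy0 i), cpol]
    split_ifs with h
    · simp only [map_pow, Polynomial.aeval_X, mul_one]; rfl
    · simp only [map_pow, map_add, Polynomial.aeval_X]
      change y i ^ (N - 1 - (j : ℕ)) + y i ^ (N - 1 + (j : ℕ)) = _
      have e : y i ^ (N - 1) = y i ^ (N - 1 - (j : ℕ)) * y i ^ (j : ℕ) := by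
        rw [← pow_add]; congr 1; omega
      rw [pow_add, e]
      exact aux2 (y i) (hy0 i) _ _
  rw [h1, h2, Matrix.det_mul_column, Matrix.det_mul_column,
    Matrix.det_eval_matrixOfPolynomials_eq_det_vandermonde (fun i => y i + (y i)⁻¹) (fun j => chb K j)
      (fun i => (chb_spec i).2) (fun i => (chb_spec i).1)]

theorem cf_AA_vand (N : ℕ) (α : Partn) (hN : α.LengthLE N) :
    cf (AA ℤ N * vandermondeP N) (ev N α) = if cls α then (-1) ^ (α.weight / 2) else 0 := by
  rw [vandermondeP_eq, AA_mul, dp_cheb, cf_dp, ← det_abs α hN]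
  congr 1
  ext i j
  have hi := i.isLt
  have hj := j.isLt
  simp only [Matrix.of_apply, cpol, ev]
  by_cases h : (j : ℕ) = 0
  · simp only [h, if_true, Polynomial.coeff_X_pow]
    congr 1
    apply propext; simp only [dd]; omega
  · rw [if_neg h]
    simp only [Polynomial.coeff_add, Polynomial.coeff_X_pow]
    by_cases h1 : α.parts i + (N - 1 - i) = N - 1 - j
    · rw [if_pos h1, if_neg (by omega), if_pos (by simp only [dd]; omega), add_zero]
    · by_cases h2 : α.parts i + (N - 1 - i) = N - 1 + j
      · rw [if_neg h1, if_pos h2, if_pos (by simp only [dd]; omega), zero_add]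
      · rw [if_neg h1, if_neg h2, if_neg (by simp only [dd]; omega), zero_add]

theorem cf_alternant (N : ℕ) (α β : Partn) (hα : α.LengthLE N) (hβ : β.LengthLE N) :
    cf (alternant N α.parts) (ev N β) = if β = α then 1 else 0 := by
  rw [alternant_eq, cf_dp]
  have := det_delta (S := ℤ) (ev N β) (ev N α) (ev_strictAnti N β) (ev_strictAnti N α)
  simp only [Polynomial.coeff_X_pow]
  refine Eq.trans this ?_
  by_cases h : β = α
  · rw [h]; simp
  · rw [if_neg h, if_neg fun h' => h (ev_inj N β α hβ hα h')]

theorem cls_weight (N : ℕ) (α : Partn) (h : cls α) (hN : α.LengthLE N) : α.weight ≤ N * N := by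
  rw [weight_eq α N hN]
  refine (Finset.sum_le_card_nsmul _ _ N fun i hi => ?_).trans (by simp)
  rw [Finset.mem_range] at hi
  have h1 := cls_lt α h hN ⟨0, by omega⟩
  have h2 := α.antitone 0 i (by omega)
  simp only [dd] at h1
  simp at h1
  omega

/-- the finite set of partitions of weight at most `M` -/
noncomputable def pset (M : ℕ) : Finset Partn := (finite_weight M).toFinset

theorem mem_pset (M : ℕ) (p : Partn) : p ∈ pset M ↔ p.weight ≤ M := by
  simp [pset]

theorem littlewood0 (N M : ℕ) (hM : N * N ≤ M) :
    AA ℤ N * vandermondeP N = ∑ α ∈ (pset M).filter (fun α => cls α ∧ α.LengthLE N),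
      C ((-1) ^ (α.weight / 2)) * alternant N α.parts := by
  rw [← sub_eq_zero]
  apply ext_cf
  intro f
  have halt : IsAlt (AA ℤ N * vandermondeP N - ∑ α ∈ (pset M).filter (fun α => cls α ∧ α.LengthLE N),
      C ((-1) ^ (α.weight / 2)) * alternant N α.parts) := by
    apply IsAlt.sub
    · rw [vandermondeP_eq, AA_mul]; exact isAlt_dp _
    · apply IsAlt.lin
      intro α _
      rw [alternant_eq]; exact isAlt_dp _
  rw [halt.eq_zero (∑ i, f i) _ f le_rfl]
  · simp [cf]
  · intro e he _
    obtain ⟨β, hβ, rfl⟩ := exists_partn N e he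
    rw [cf_sub, cf_AA_vand N β hβ, cf_sum, sub_eq_zero]
    rw [Finset.sum_congr rfl (g := fun α => if β = α then (-1) ^ (α.weight / 2) else 0)]
    · rw [Finset.sum_ite_eq]
      congr 1
      apply propext
      simp only [Finset.mem_filter, mem_pset]
      exact ⟨fun h => ⟨(cls_weight N β h hβ).trans hM, h, hβ⟩, fun h => h.2.1⟩
    · intro α hα
      rw [cf_C_mul, cf_alternant N α β (Finset.mem_filter.1 hα).2.2 hβ]
      simp

theorem vand_ne_zero (N : ℕ) : vandermondeP N ≠ 0 := by
  intro h
  have h1 := cf_alternant N ⟨fun _ => 0, by simp, ⟨0, by simp⟩⟩ ⟨fun _ => 0, by simp, ⟨0, by simp⟩⟩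
    (fun _ _ => rfl) (fun _ _ => rfl)
  have h2 : alternant N (fun _ => 0) = vandermondeP N := by
    unfold alternant vandermondeP; simp
  simp only at h1
  rw [h2, h] at h1
  simp [cf] at h1

theorem littlewood (N M : ℕ) (hM : N * N ≤ M) :
    AA ℤ N = ∑ α ∈ (pset M).filter (fun α => cls α ∧ α.LengthLE N),
      C ((-1) ^ (α.weight / 2)) * schur N α.parts := by
  apply mul_right_cancel₀ (vand_ne_zero N)
  rw [littlewood0 N M hM, Finset.sum_mul]
  refine Finset.sum_congr rfl fun α _ => ?_
  rw [mul_assoc, schur_mul]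

/-- scaling of variables by 2 -/
noncomputable def scl (N : ℕ) : MvPolynomial (Fin N) ℤ →ₐ[ℤ] MvPolynomial (Fin N) ℤ :=
  aeval (fun i => 2 * X i)

theorem cf_scl (N : ℕ) (P : MvPolynomial (Fin N) ℤ) (f : Fin N → ℕ) :
    cf (scl N P) f = 2 ^ (∑ i, f i) * cf P f := by
  induction P using MvPolynomial.induction_on' with
  | monomial u a =>
    have h : scl N (monomial u a) = C (2 ^ (∑ i, u i)) * monomial u a := by
      rw [scl, aeval_monomial, MvPolynomial.monomial_eq, Finsupp.prod_fintype _ _ (by simp),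
        Finsupp.prod_fintype _ _ (by simp)]
      simp only [mul_pow, Finset.prod_mul_distrib, Finset.prod_pow_eq_pow_sum]
      simp
      ring
    rw [h, cf_C_mul]
    unfold cf
    rw [coeff_monomial]
    split_ifs with h2
    · rw [h2]; simp
    · simp
  | add p q hp hq =>
    have : ∀ a b : MvPolynomial (Fin N) ℤ, cf (a + b) f = cf a f + cf b f := by
      intro a b; simp [cf]
    rw [map_add, this, this, hp, hq]; ring

theorem scl_alternant (N : ℕ) (l : ℕ → ℕ) :
    scl N (alternant N l) = C (2 ^ (∑ j : Fin N, (l j + (N - 1 - (j : ℕ))))) * alternant N l := by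
  unfold alternant
  rw [AlgHom.map_det]
  have h := Matrix.det_mul_row (fun j : Fin N => (2 : MvPolynomial (Fin N) ℤ) ^ (l j + (N - 1 - (j : ℕ))))
    (Matrix.of fun i j : Fin N => (X i : MvPolynomial (Fin N) ℤ) ^ (l (j : ℕ) + (N - 1 - (j : ℕ))))
  rw [Finset.prod_pow_eq_pow_sum] at h
  rw [map_pow, show (C 2 : MvPolynomial (Fin N) ℤ) = 2 by simp, ← h]
  congr 1
  ext1 i j
  simp [scl, mul_pow]

theorem schur_homog (N : ℕ) (α : Partn) (hα : α.LengthLE N) (f : Fin N → ℕ)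
    (hf : ∑ i, f i ≠ α.weight) : cf (schur N α.parts) f = 0 := by
  have h0 : alternant N (fun _ => 0) = vandermondeP N := by
    unfold alternant vandermondeP; simp
  have h1 := congrArg (scl N) (schur_mul N α.parts)
  rw [map_mul, scl_alternant, ← h0, scl_alternant, h0, ← schur_mul] at h1
  have h2 : scl N (schur N α.parts) = C (2 ^ α.weight) * schur N α.parts := by
    have hc : (C (2 ^ (∑ j : Fin N, (0 + (N - 1 - (j : ℕ))))) : MvPolynomial (Fin N) ℤ) ≠ 0 := by
      rw [Ne, MvPolynomial.C_eq_zero]; positivity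
    apply mul_right_cancel₀ (mul_ne_zero hc (vand_ne_zero N))
    rw [h1, Finset.sum_add_distrib, Finset.sum_add_distrib, pow_add, pow_add, map_mul, map_mul,
      weight_eq α N hα, Finset.sum_range]
    simp
    ring
  have h3 := cf_scl N (schur N α.parts) f
  rw [h2, cf_C_mul] at h3
  by_contra hne
  have h4 := mul_right_cancel₀ hne h3
  exact hf (Nat.pow_right_injective (le_refl 2) (by exact_mod_cast h4.symm))

end
end SpU


namespace SpU

theorem amap_inj (k : ℕ) : Function.Injective (algebraMap (MvPolynomial (Fin k) ℚ) (RatFn k)) :=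
  IsFractionRing.injective _ _

theorem xv_ne_zero (k : ℕ) (i : Fin k) : xv k i ≠ 0 := by
  unfold xv
  rw [Ne, map_eq_zero_iff _ (amap_inj k)]
  exact X_ne_zero i

theorem xv_inj (k : ℕ) : Function.Injective (xv k) := by
  intro i j h
  exact MvPolynomial.X_injective (amap_inj k h)

theorem xv_mul_ne (k : ℕ) (i j : Fin k) : xv k i * xv k j ≠ 1 := by
  unfold xv
  rw [← map_mul, ← map_one (algebraMap (MvPolynomial (Fin k) ℚ) (RatFn k))]
  intro h
  have := congrArg (MvPolynomial.eval (fun _ => (0 : ℚ))) (amap_inj k h)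
  simp at this

theorem eq_inv_iff_aux {F : Type*} [Field F] {x y : F} (hy : y ≠ 0) : x = y⁻¹ ↔ x * y = 1 :=
  (mul_eq_one_iff_eq_inv₀ hy).symm

theorem spEval_inj (k : ℕ) : Function.Injective (spEval k) := by
  intro i j h
  have hi := i.isLt
  have hj := j.isLt
  unfold spEval at h
  apply Fin.ext
  split_ifs at h with h1 h2 h2
  · simpa using xv_inj k h
  · exfalso
    rw [eq_inv_iff_aux (xv_ne_zero _ _)] at h
    exact xv_mul_ne _ _ _ h
  · exfalso
    rw [inv_eq_iff_eq_inv, eq_inv_iff_aux (xv_ne_zero _ _)] at h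
    exact xv_mul_ne _ _ _ h
  · have := xv_inj k (inv_injective h)
    simp only [Fin.mk.injEq] at this
    omega

noncomputable def wv (k : ℕ) (i : Fin k) : RatFn k := xv k i + (xv k i)⁻¹
noncomputable def gv (k : ℕ) (i : Fin k) : RatFn k := xv k i - (xv k i)⁻¹

theorem gv_ne (k : ℕ) (i : Fin k) : gv k i ≠ 0 := by
  unfold gv
  rw [Ne, sub_eq_zero, eq_inv_iff_aux (xv_ne_zero _ _)]
  exact xv_mul_ne _ _ _

theorem wv_inj (k : ℕ) : Function.Injective (wv k) := by
  intro i j h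
  unfold wv at h
  have hi := xv_ne_zero k i
  have hj := xv_ne_zero k j
  have h1 : (xv k i - xv k j) * (xv k i * xv k j - 1) = 0 := by
    field_simp at h
    linear_combination h
  rcases mul_eq_zero.1 h1 with h2 | h2
  · exact xv_inj k (sub_eq_zero.1 h2)
  · exact absurd (sub_eq_zero.1 h2) (xv_mul_ne _ _ _)

noncomputable def Kv (k : ℕ) (i : Fin k) : PowerSeries (RatFn k) :=
  PowerSeries.mk fun e => xv k i ^ (e + 1) - (xv k i)⁻¹ ^ (e + 1)

theorem Kv_mul_gen {F : Type*} [Field F] (x : F) (hx : x ≠ 0) :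
    (PowerSeries.mk fun e => x ^ (e + 1) - x⁻¹ ^ (e + 1)) *
     (1 + PowerSeries.C 1 * PowerSeries.X ^ 2 - PowerSeries.C (x + x⁻¹) * PowerSeries.X)
      = PowerSeries.C (x - x⁻¹) := by
  have h1 := geom_ps x
  have h2 := geom_ps x⁻¹
  simp only [map_zero, zero_mul, add_zero] at h1 h2
  have hC : (PowerSeries.C x : PowerSeries F) * PowerSeries.C x⁻¹ = 1 := by
    rw [← map_mul, mul_inv_cancel₀ hx, map_one]
  have h3 : (PowerSeries.mk fun e => x ^ (e + 1) - x⁻¹ ^ (e + 1)) =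
      PowerSeries.C x * PowerSeries.mk (fun e => x ^ e) -
      PowerSeries.C x⁻¹ * PowerSeries.mk (fun e => x⁻¹ ^ e) := by
    ext e
    simp [PowerSeries.coeff_C_mul, pow_succ']
  rw [h3, map_add, map_sub]
  rw [map_one] at *
  generalize PowerSeries.mk (fun e => x ^ e) = U at *
  generalize PowerSeries.mk (fun e => x⁻¹ ^ e) = V at *
  generalize (PowerSeries.C x : PowerSeries F) = a at *
  generalize (PowerSeries.C x⁻¹ : PowerSeries F) = b at *
  generalize (PowerSeries.X : PowerSeries F) = t at *
  have e : 1 + 1 * t ^ 2 - (a + b) * t = (1 - a * t) * (1 - b * t) := by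
    linear_combination - t ^ 2 * hC
  rw [e]
  linear_combination (a * (1 - b * t)) * h1 - (b * (1 - a * t)) * h2

noncomputable def Qv (k : ℕ) : PowerSeries (RatFn k) :=
  ∏ i : Fin (2 * k), (1 - PowerSeries.C (spEval k i) * PowerSeries.X)

theorem Qv_eq (k : ℕ) : Qv k =
    ∏ i : Fin k, (1 + PowerSeries.C 1 * PowerSeries.X ^ 2 - PowerSeries.C (wv k i) * PowerSeries.X) := by
  unfold Qv
  have e : k + k = 2 * k := by ring
  rw [← Equiv.prod_comp (finCongr e), Fin.prod_univ_add, ← Finset.prod_mul_distrib]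
  refine Finset.prod_congr rfl fun i _ => ?_
  have h1 : spEval k (finCongr e (Fin.castAdd k i)) = xv k i := by
    unfold spEval
    rw [dif_pos (by simp)]
    simp
  have h2 : spEval k (finCongr e (Fin.natAdd k i)) = (xv k i)⁻¹ := by
    unfold spEval
    rw [dif_neg (by simp)]
    simp
  rw [h1, h2, wv, map_add]
  have hC : (PowerSeries.C (xv k i) : PowerSeries (RatFn k)) * PowerSeries.C (xv k i)⁻¹ = 1 := by
    rw [← map_mul, mul_inv_cancel₀ (xv_ne_zero k i), map_one]
  rw [map_one]
  linear_combination PowerSeries.X ^ 2 * hC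

theorem exists_H (k : ℕ) : ∃ H : PowerSeries (RatFn k), H * Qv k = 1 := by
  refine ⟨(Qv k)⁻¹, PowerSeries.inv_mul_cancel _ ?_⟩
  unfold Qv
  simp [map_prod]

theorem spChar_eq (k : ℕ) (H : PowerSeries (RatFn k)) (hH : H * Qv k = 1) (l : ℕ → ℕ) :
    spChar k l = jd 1 H l k := by
  rw [Qv_eq] at hH
  have hK : ∀ i, Kv k i * (1 + PowerSeries.C 1 * PowerSeries.X ^ 2 -
      PowerSeries.C (wv k i) * PowerSeries.X) = PowerSeries.C (gv k i) := fun i =>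
    Kv_mul_gen (xv k i) (xv_ne_zero k i)
  have h1 := jd_mul 1 (wv k) (gv k) H (Kv k) hH hK l
  have h2 := det_km 1 (wv k) (gv k) H (Kv k) hH hK
  have h3 : (Matrix.of fun i m : Fin k => PowerSeries.coeff (k - 1 - i) (Kv k m)).det ≠ 0 := by
    rw [h2]; exact bm_ne_zero _ _ (wv_inj k) (gv_ne k)
  rw [← eq_div_iff h3] at h1
  rw [h1, spChar, ← Matrix.det_transpose, ← Matrix.det_transpose (Matrix.of fun i j : Fin k =>
      xv k i ^ (((k - (j : ℕ) : ℕ)) : ℤ) - xv k i ^ (-((k - (j : ℕ) : ℕ) : ℤ)))]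
  congr 2
  · ext i m
    have := i.isLt
    simp only [Matrix.transpose_apply, Matrix.of_apply, Kv, PowerSeries.coeff_mk]
    rw [show l i + (k - 1 - i) + 1 = l i + (k - i) by omega, zpow_neg, zpow_natCast, inv_pow]
  · ext i m
    have := i.isLt
    simp only [Matrix.transpose_apply, Matrix.of_apply, Kv, PowerSeries.coeff_mk]
    rw [show (k - 1 - i) + 1 = (k - i : ℕ) by omega, zpow_neg, zpow_natCast, inv_pow]

end SpU


namespace SpU

section
variable {S : Type*} [CommRing S] {N : ℕ}

theorem aeval_irrel {F : Type*} [CommRing F] (i1 i2 : Algebra ℤ F) {q : ℕ} (z : Fin q → F)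
    (p : MvPolynomial (Fin q) ℤ) : (@aeval ℤ F (Fin q) _ _ i1 z) p = (@aeval ℤ F (Fin q) _ _ i2 z) p := by
  have : i1 = i2 := Subsingleton.elim _ _
  subst this
  rfl

theorem cf_mul_congr (A P Q : MvPolynomial (Fin N) S) (d : ℕ)
    (h : ∀ f, ∑ i, f i ≤ d → cf P f = cf Q f) (f : Fin N → ℕ) (hf : ∑ i, f i ≤ d) :
    cf (A * P) f = cf (A * Q) f := by
  unfold cf
  rw [coeff_mul, coeff_mul]
  refine Finset.sum_congr rfl fun x hx => ?_
  congr 1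
  have h1 := h (fun i => x.2 i) ?_
  · unfold cf at h1
    convert h1 <;> (ext i; simp)
  · refine le_trans (Finset.sum_le_sum fun i _ => ?_) hf
    have := DFunLike.congr_fun (Finset.HasAntidiagonal.mem_antidiagonal.1 hx) i
    simp at this
    omega

theorem cf_mul_zero (A P : MvPolynomial (Fin N) S) (a b : ℕ)
    (hA : ∀ f, ∑ i, f i ≠ a → cf A f = 0) (hP : ∀ f, ∑ i, f i ≠ b → cf P f = 0)
    (f : Fin N → ℕ) (hf : ∑ i, f i ≠ a + b) : cf (A * P) f = 0 := by
  unfold cf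
  rw [coeff_mul]
  refine Finset.sum_eq_zero fun x hx => ?_
  have hs : ∑ i, f i = ∑ i, x.1 i + ∑ i, x.2 i := by
    rw [← Finset.sum_add_distrib]
    refine Finset.sum_congr rfl fun i _ => ?_
    have := DFunLike.congr_fun (Finset.HasAntidiagonal.mem_antidiagonal.1 hx) i
    simp at this
    omega
  by_cases h1 : ∑ i, x.1 i = a
  · have h2 := hP (fun i => x.2 i) (by omega)
    unfold cf at h2
    have e : x.2 = Finsupp.equivFunOnFinite.symm (fun i => x.2 i) := by ext i; simp
    rw [← e] at h2
    rw [h2, mul_zero]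
  · have h2 := hA (fun i => x.1 i) h1
    unfold cf at h2
    have e : x.1 = Finsupp.equivFunOnFinite.symm (fun i => x.1 i) := by ext i; simp
    rw [← e] at h2
    rw [h2, zero_mul]

theorem alternant_homog (N : ℕ) (α : Partn) (hα : α.LengthLE N) (f : Fin N → ℕ)
    (hf : ∑ i, f i ≠ α.weight + ∑ i : Fin N, (N - 1 - i)) : cf (alternant N α.parts) f = 0 := by
  have h3 := cf_scl N (alternant N α.parts) f
  rw [scl_alternant, cf_C_mul] at h3
  by_contra hne
  have h4 := mul_right_cancel₀ hne h3
  have h5 := Nat.pow_right_injective (le_refl 2) (by exact_mod_cast h4.symm :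
    2 ^ (∑ i, f i) = 2 ^ _)
  have h6 := sum_ev N α hα
  unfold ev at h6
  exact hf (h5.trans h6)

/-- the alternant over `S` -/
noncomputable def altS (S : Type*) [CommRing S] (N : ℕ) (l : ℕ → ℕ) : MvPolynomial (Fin N) S :=
  dp (fun j : Fin N => (Polynomial.X : Polynomial S) ^ (l j + (N - 1 - (j : ℕ))))

theorem map_alternant (N : ℕ) (l : ℕ → ℕ) :
    MvPolynomial.map (Int.castRingHom S) (alternant N l) = altS S N l := by
  unfold alternant altS dp
  rw [RingHom.map_det]
  congr 1
  ext1 i j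
  simp

theorem map_AA (N : ℕ) : MvPolynomial.map (Int.castRingHom S) (AA ℤ N) = AA S N := by
  unfold AA
  simp [map_prod]

theorem cf_map (P : MvPolynomial (Fin N) ℤ) (f : Fin N → ℕ) :
    cf (MvPolynomial.map (Int.castRingHom S) P) f = ((cf P f : ℤ) : S) := by
  unfold cf
  rw [coeff_map]; rfl

theorem cf_altS (N : ℕ) (α β : Partn) (hα : α.LengthLE N) (hβ : β.LengthLE N) :
    cf (altS S N α.parts) (ev N β) = if β = α then 1 else 0 := by
  rw [← map_alternant, cf_map, cf_alternant N α β hα hβ]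
  split_ifs <;> simp

theorem dp_mul (p : Fin N → Polynomial S) (q : Polynomial S) :
    dp (fun j => p j * q) = (∏ i, Polynomial.aeval (X i : MvPolynomial (Fin N) S) q) * dp p := by
  unfold dp
  rw [← Matrix.det_mul_column]
  congr 1
  ext1 i j
  simp [mul_comm]

theorem coeff_trunc_mul (p : Polynomial S) (H : PowerSeries S) (D e : ℕ) (h : e < D) :
    (p * PowerSeries.trunc D H).coeff e = PowerSeries.coeff e ((p : PowerSeries S) * H) := by
  rw [Polynomial.coeff_mul, PowerSeries.coeff_mul]
  refine Finset.sum_congr rfl fun x hx => ?_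
  have := Finset.HasAntidiagonal.mem_antidiagonal.1 hx
  rw [PowerSeries.coeff_trunc, if_pos (by omega), Polynomial.coeff_coe]

theorem jd_len_zero [IsDomain S] {q : ℕ} (w : Fin q → S) (H : PowerSeries S)
    (hH : H * ∏ i, (1 - PowerSeries.C (w i) * PowerSeries.X) = 1)
    (ν : Partn) (N : ℕ) (hN : ν.LengthLE N) (hq : ¬ ν.LengthLE q) : jd 0 H ν.parts N = 0 := by
  have hc : PowerSeries.constantCoeff H = 1 := by
    have := congrArg (PowerSeries.constantCoeff (R := S)) hH
    simpa [map_mul, map_prod] using this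
  have hex : ∃ n, ν.LengthLE n := ⟨N, hN⟩
  have hlt : q < Nat.find hex := by
    by_contra h
    exact hq (fun i hi => Nat.find_spec hex i (by omega))
  obtain ⟨n, hn⟩ : ∃ n, Nat.find hex = n + 1 := ⟨Nat.find hex - 1, by omega⟩
  rw [jd_stable 0 H hc ν.parts N (n + 1) hN (hn ▸ Nat.find_spec hex)]
  apply jd_vanish w H hH _ n (by omega)
  intro i hi h0
  refine Nat.find_min hex (m := n) (by omega) (fun j hj => ?_)
  have := ν.antitone i j (by omega)
  omega

theorem cauchy [IsDomain S] {q : ℕ} (z : Fin q → S) (hz : Function.Injective z) (H : PowerSeries S)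
    (hH : H * ∏ i, (1 - PowerSeries.C (z i) * PowerSeries.X) = 1) (N : ℕ) (l : Partn)
    (hl : l.weight ≤ N) :
    ∑ μ ∈ (pset N).filter (fun μ => μ.LengthLE q),
      aeval z (schur q μ.parts) * cf (AA S N * altS S N μ.parts) (ev N l) = jd 1 H l.parts N := by
  have hc : PowerSeries.constantCoeff H = 1 := by
    have := congrArg (PowerSeries.constantCoeff (R := S)) hH
    simpa [map_mul, map_prod] using this
  set d := N + ∑ i : Fin N, (N - 1 - (i : ℕ)) with hd
  set T := PowerSeries.trunc (d + 1) H with hT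
  set G := dp (fun j : Fin N => (Polynomial.X : Polynomial S) ^ (N - 1 - (j : ℕ)) * T) with hG
  set Q := ∑ μ ∈ (pset N).filter (fun μ => μ.LengthLE q),
    C (aeval z (schur q μ.parts)) * altS S N μ.parts with hQ
  have hll : l.LengthLE N := lengthLE_of_weight l N hl
  have hle : ∑ i, ev N l i ≤ d := by rw [sum_ev N l hll]; omega
  have hQG : ∀ f : Fin N → ℕ, ∑ i, f i ≤ d → cf Q f = cf G f := by
    intro f hf
    have halt : IsAlt (Q - G) := by
      apply IsAlt.sub
      · exact IsAlt.lin _ _ _ fun μ _ => isAlt_dp _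
      · exact isAlt_dp _
    rw [← sub_eq_zero, ← cf_sub]
    refine halt.eq_zero d (fun e he hed => ?_) f hf
    obtain ⟨ν, hν, rfl⟩ := exists_partn N e he
    have hνw : ν.weight ≤ N := by
      rw [sum_ev N ν hν] at hed; omega
    have hGν : cf G (ev N ν) = jd 0 H ν.parts N := by
      rw [hG, cf_dp, jd]
      congr 1
      ext i j
      simp only [Matrix.of_apply]
      have h1 : ev N ν i ≤ d := le_trans (Finset.single_le_sum (fun _ _ => Nat.zero_le _) (Finset.mem_univ i)) hed
      rw [jm_eq 0 H ν.parts N i j i.isLt j.isLt, coeff_trunc_mul _ _ _ _ (by omega)]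
      simp [ev]
    have hQν : cf Q (ev N ν) = if ν.LengthLE q then aeval z (schur q ν.parts) else 0 := by
      rw [hQ, cf_sum, Finset.sum_congr rfl (g := fun μ => if ν = μ then aeval z (schur q μ.parts) else 0)]
      · rw [Finset.sum_ite_eq]
        simp only [Finset.mem_filter, mem_pset]
        simp [hνw]
      · intro μ hμ
        simp only [Finset.mem_filter, mem_pset] at hμ
        rw [cf_C_mul, cf_altS N μ ν (lengthLE_of_weight μ N hμ.1) hν]
        simp
    rw [cf_sub, hGν, hQν, sub_eq_zero]
    split_ifs with h
    · rw [schur_eval q z hz H hH, jd_stable 0 H hc ν.parts q N h hν]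
    · rw [jd_len_zero z H hH ν N hν h]
  have h1 : ∑ μ ∈ (pset N).filter (fun μ => μ.LengthLE q),
      aeval z (schur q μ.parts) * cf (AA S N * altS S N μ.parts) (ev N l) = cf (AA S N * Q) (ev N l) := by
    rw [hQ, Finset.mul_sum, cf_sum]
    refine Finset.sum_congr rfl fun μ _ => ?_
    rw [mul_left_comm, cf_C_mul]
  rw [h1, cf_mul_congr (AA S N) Q G d hQG _ hle, hG, dp_mul, mul_left_comm, AA_mul, ← dp_mul, cf_dp, jd]
  congr 1
  ext i j
  simp only [Matrix.of_apply]
  have h1 : ev N l i ≤ d := le_trans (Finset.single_le_sum (fun _ _ => Nat.zero_le _) (Finset.mem_univ i)) hle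
  rw [jm_eq 1 H l.parts N i j i.isLt j.isLt, coeff_trunc_mul _ _ _ _ (by omega)]
  simp [ev, mul_assoc]

theorem lr_eq (α μ l : Partn) (h : α.weight + μ.weight = l.weight) :
    lrCoeff α μ l = cf (schur l.weight α.parts * alternant l.weight μ.parts) (ev l.weight l) := by
  rw [← schur_mul, ← mul_assoc]
  unfold lrCoeff ev cf
  rw [if_pos h.symm]
  generalize l.weight = n at *
  subst h
  rfl

theorem sum_alpha (μ l : Partn) (hμ : μ.weight ≤ l.weight) (M : ℕ) (hM : l.weight * l.weight + l.weight ≤ M) :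
    ∑ α ∈ (pset M).filter (fun α => cls α ∧ α.weight + μ.weight = l.weight),
      (-1) ^ (α.weight / 2) * lrCoeff α μ l =
    cf (AA ℤ l.weight * alternant l.weight μ.parts) (ev l.weight l) := by
  have hl := lengthLE_weight l
  have hμl := lengthLE_of_weight μ _ hμ
  rw [littlewood l.weight M (by omega), Finset.sum_mul, cf_sum]
  have hsub : (pset M).filter (fun α => cls α ∧ α.weight + μ.weight = l.weight) ⊆
      (pset M).filter (fun α => cls α ∧ α.LengthLE l.weight) := by
    intro α
    simp only [Finset.mem_filter]
    rintro ⟨h1, h2, h3⟩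
    exact ⟨h1, h2, lengthLE_of_weight α _ (by omega)⟩
  rw [← Finset.sum_subset hsub]
  · refine Finset.sum_congr rfl fun α hα => ?_
    simp only [Finset.mem_filter] at hα
    rw [lr_eq α μ l hα.2.2, mul_assoc, cf_C_mul]
  · intro α h1 h2
    simp only [Finset.mem_filter] at h1 h2
    have h3 : α.weight + μ.weight ≠ l.weight := fun h => h2 ⟨h1.1, h1.2.1, h⟩
    rw [mul_assoc, cf_C_mul, cf_mul_zero _ _ α.weight (μ.weight + ∑ i : Fin l.weight, (l.weight - 1 - (i : ℕ)))
      (schur_homog _ α h1.2.2) (alternant_homog _ μ hμl) _ (by rw [sum_ev _ l hl]; omega), mul_zero]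

theorem finsum_conv {F : Type*} [AddCommMonoid F] (P : Partn → Partn → Prop) (t : Partn → Partn → F) (M : ℕ)
    (hP : ∀ α μ, P α μ → α.weight ≤ M ∧ μ.weight ≤ M) :
    ∑ᶠ (α : Partn) (μ : Partn) (_ : P α μ), t α μ =
      ∑ α ∈ pset M, ∑ μ ∈ pset M, if P α μ then t α μ else 0 := by
  have h1 : ∀ α, ∑ᶠ (μ : Partn) (_ : P α μ), t α μ = ∑ μ ∈ pset M, if P α μ then t α μ else 0 := by
    intro α
    rw [← finsum_eq_sum_of_support_subset]
    · refine finsum_congr fun μ => ?_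
      rw [finsum_eq_if]
    · intro μ hμ
      rw [Function.mem_support] at hμ
      have : P α μ := by by_contra h; simp [h] at hμ
      simpa [mem_pset] using (hP α μ this).2
  rw [finsum_congr h1]
  apply finsum_eq_sum_of_support_subset
  intro α hα
  rw [Function.mem_support] at hα
  obtain ⟨μ, _, h2⟩ := Finset.exists_ne_zero_of_sum_ne_zero hα
  have : P α μ := by by_contra h; simp [h] at h2
  simpa [mem_pset] using (hP α μ this).1

end
end SpU

theorem sp_universal (k : ℕ) (hk : 0 < k) (l : Partn) (hl : l.LengthLE k) :
    spChar k l.parts =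
    ∑ᶠ (α : Partn) (μ : Partn)
        (_ : (∀ i, i < α.parts i → α.conjParts i = α.parts i + 1) ∧
          μ.LengthLE (2 * k) ∧ α.weight + μ.weight = l.weight),
      (((-1 : ℤ) ^ (α.weight / 2) * lrCoeff α μ l : ℤ) : RatFn k) *
        MvPolynomial.aeval (spEval k) (schur (2 * k) μ.parts) := by
  obtain ⟨H, hH⟩ := SpU.exists_H k
  have hc : PowerSeries.constantCoeff H = 1 := by
    rw [SpU.Qv_eq] at hH
    exact SpU.const_one 1 _ H hH
  set M := l.weight * l.weight + l.weight with hM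
  rw [SpU.spChar_eq k H hH, SpU.jd_stable 1 H hc l.parts k l.weight hl (SpU.lengthLE_weight l),
    ← SpU.cauchy (spEval k) (SpU.spEval_inj k) H hH l.weight l le_rfl,
    SpU.finsum_conv (fun α μ => (∀ i, i < α.parts i → α.conjParts i = α.parts i + 1) ∧
          μ.LengthLE (2 * k) ∧ α.weight + μ.weight = l.weight) _ M
      (fun α μ h => ⟨by omega, by omega⟩), Finset.sum_comm]
  have hsub : (SpU.pset l.weight).filter (fun μ => μ.LengthLE (2 * k)) ⊆ SpU.pset M := by
    intro μ
    simp only [Finset.mem_filter, SpU.mem_pset]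
    omega
  rw [← Finset.sum_subset hsub]
  · refine Finset.sum_congr rfl fun μ hμ => ?_
    simp only [Finset.mem_filter, SpU.mem_pset] at hμ
    rw [← SpU.map_AA, ← SpU.map_alternant, ← map_mul, SpU.cf_map,
      ← SpU.sum_alpha μ l hμ.1 M le_rfl, mul_comm, Int.cast_sum, Finset.sum_mul, Finset.sum_filter]
    refine Finset.sum_congr rfl fun α _ => ?_
    by_cases h : SpU.cls α ∧ α.weight + μ.weight = l.weight
    · rw [if_pos h, if_pos ⟨h.1, hμ.2, h.2⟩]
      congr 1
      exact SpU.aeval_irrel _ _ (spEval k) _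
    · rw [if_neg h, if_neg fun h' => h ⟨h'.1, h'.2.2⟩]
  · intro μ _ h2
    refine Finset.sum_eq_zero fun α _ => if_neg fun h => h2 ?_
    simp only [Finset.mem_filter, SpU.mem_pset]
    exact ⟨by omega, h.2.1⟩
end
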